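/- arXiv:1908.05259 — 3 statements merged into one kernel-verified Lean document; each statement's English description precedes it below -/
import Mathlib

section
/- Let G ⊆ GL_n(F_p) fix a hyperplane H pointwise, with transvection root space of dimension ℓ = dim_{F_p}(RootSpace(G) ∩ H), and let e be the maximal order of a semisimple element of G. Then the dimension over F_p of the G-invariants in F_p[x_1,...,x_n]/(x_1^{p^m},...,x_n^{p^m}) equals p^{m(n-1)} + p^{m(n-1) - ℓ}·(p^m − 1)/e. -/
open MvPolynomial Matrix

/-- The `m`-th Frobenius power of the irrelevant ideal, `(x_1^N, …, x_n^N)`. -/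
noncomputable def frobIdeal (F : Type) [Field F] (n N : ℕ) : Ideal (MvPolynomial (Fin n) F) :=
  Ideal.span (Set.range fun i : Fin n => (X i : MvPolynomial (Fin n) F) ^ N)

/-- The substitution action of `g ∈ GL_n(F)` on polynomials: `x_i ↦ Σ_j g_{ij} x_j`. -/
noncomputable def gSub {F : Type} [Field F] {n : ℕ} (g : GL (Fin n) F) :
    MvPolynomial (Fin n) F →ₐ[F] MvPolynomial (Fin n) F :=
  aeval fun i => ∑ j, C ((g : Matrix (Fin n) (Fin n) F) i j) * X j

/-- Polynomials `f` with `g·f ≡ f mod (x_1^N,…,x_n^N)` for all `g ∈ G`. -/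
noncomputable def invLift {F : Type} [Field F] {n : ℕ} (G : Subgroup (GL (Fin n) F)) (N : ℕ) :
    Submodule F (MvPolynomial (Fin n) F) :=
  ⨅ g ∈ G, Submodule.comap ((gSub g).toLinearMap - LinearMap.id)
    ((frobIdeal F n N).restrictScalars F)

/-- The `G`-invariant subspace of `S/(x_1^N,…,x_n^N)`. -/
noncomputable def invQuot {F : Type} [Field F] {n : ℕ} (G : Subgroup (GL (Fin n) F)) (N : ℕ) :
    Submodule F (MvPolynomial (Fin n) F ⧸ frobIdeal F n N) :=
  (invLift G N).map (Ideal.Quotient.mkₐ F (frobIdeal F n N)).toLinearMap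


/-- The homogenized falling factorial `x (x - y) (x - 2 y) ⋯ (x - (j - 1) y)`. -/
def fallingProd {A : Type*} [CommRing A] (x y : A) (j : ℕ) : A :=
  ∏ r ∈ Finset.range j, (x - r * y)

section fallingProd

variable {A : Type*} [CommRing A]

theorem fallingProd_add (x y : A) (j : ℕ) :
    fallingProd (x + y) y j = fallingProd x y j + j * (y * fallingProd x y (j - 1)) := by
  cases j with
  | zero => simp [fallingProd]
  | succ j =>
    have h : fallingProd (x + y) y (j + 1) = (x + y) * fallingProd x y j := by
      rw [fallingProd, Finset.prod_range_succ', mul_comm]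
      congr 1
      · simp
      · refine Finset.prod_congr rfl fun r _ => ?_
        push_cast
        ring
    rw [h, Nat.add_sub_cancel, fallingProd, fallingProd, Finset.prod_range_succ]
    push_cast
    ring

theorem dvd_fallingProd_sub_pow (x y : A) (j : ℕ) : y ∣ fallingProd x y j - x ^ j := by
  rw [← Ideal.mem_span_singleton, ← Ideal.Quotient.eq, fallingProd, map_prod]
  have hy : Ideal.Quotient.mk (Ideal.span {y}) y = 0 :=
    Ideal.Quotient.eq_zero_iff_mem.2 (Ideal.mem_span_singleton_self y)
  simp [hy]

theorem map_fallingProd {B H : Type*} [CommRing B] [FunLike H A B] [RingHomClass H A B]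
    (g : H) (x y : A) (j : ℕ) : g (fallingProd x y j) = fallingProd (g x) (g y) j := by
  simp [fallingProd]

theorem Finset.prod_range_cast_zmod (p : ℕ) [NeZero p] (f : ZMod p → A) :
    ∏ r ∈ Finset.range p, f r = ∏ c, f c := by
  refine Finset.prod_bij' (fun r _ => (r : ZMod p)) (fun c _ => c.val) ?_ ?_ ?_ ?_ ?_
  · simp
  · exact fun c _ => Finset.mem_range.2 c.val_lt
  · exact fun r hr => ZMod.val_cast_of_lt (Finset.mem_range.1 hr)
  · simp
  · simp

variable {p : ℕ} [Fact p.Prime] [Algebra (ZMod p) A]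

theorem fallingProd_mul_char (x y : A) (b : ℕ) :
    fallingProd x y (p * b) = (∏ c : ZMod p, (x - c • y)) ^ b := by
  have hc : ∀ r : ℕ, (r : A) * y = (r : ZMod p) • y := fun r => by
    rw [Nat.cast_smul_eq_nsmul, nsmul_eq_mul]
  induction b with
  | zero => simp [fallingProd]
  | succ b ih =>
    rw [pow_succ, ← ih, mul_add, mul_one, fallingProd, Finset.prod_range_add]
    congr 1
    rw [← Finset.prod_range_cast_zmod]
    refine Finset.prod_congr rfl fun r _ => ?_
    rw [hc]
    simp

theorem fallingProd_mul_char_affine (x y : A) (a ω : ZMod p) (hω : ω ≠ 0) (b : ℕ) :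
    fallingProd (x + a • y) (ω • y) (p * b) = fallingProd x y (p * b) := by
  rw [fallingProd_mul_char, fallingProd_mul_char]
  congr 1
  have hbij : Function.Bijective fun c : ZMod p => c * ω - a := by
    refine Finite.injective_iff_bijective.1 fun c d h => ?_
    simpa [hω] using h
  refine Fintype.prod_bijective _ hbij _ _ fun c => ?_
  rw [sub_smul, smul_smul]
  abel

end fallingProd

section basis

variable {A : Type*} [CommRing A] {ι : Type*} [DecidableEq ι]

/-- `x_i ^ j`, replaced by a falling factorial with step `x_o` when `i ∈ L`. -/
def twistedPow (x : ι → A) (o : ι) (L : Finset ι) (i : ι) (j : ℕ) : A :=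
  if i ∈ L then fallingProd (x i) (x o) j else x i ^ j

theorem dvd_twistedPow_sub_pow (x : ι → A) (o : ι) (L : Finset ι) (i : ι) (j : ℕ) :
    x o ∣ twistedPow x o L i j - x i ^ j := by
  unfold twistedPow
  split_ifs
  · exact dvd_fallingProd_sub_pow _ _ _
  · simp

theorem Finset.dvd_prod_sub_prod {κ : Type*} (s : Finset κ) (y : A) (f g : κ → A)
    (h : ∀ i ∈ s, y ∣ f i - g i) : y ∣ ∏ i ∈ s, f i - ∏ i ∈ s, g i := by
  rw [← Ideal.mem_span_singleton, ← Ideal.Quotient.eq, map_prod, map_prod]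
  refine Finset.prod_congr rfl fun i hi => ?_
  rw [Ideal.Quotient.eq, Ideal.mem_span_singleton]
  exact h i hi

variable [Fintype ι]

/-- The product of the `twistedPow`s with exponents `d`. -/
def twistedMonomial (x : ι → A) (o : ι) (L : Finset ι) (d : ι → ℕ) : A :=
  ∏ i, twistedPow x o L i (d i)

variable {x : ι → A} {o : ι} {L : Finset ι}

theorem twistedMonomial_eq_mul (ho : o ∉ L) (d : ι → ℕ) :
    twistedMonomial x o L d
      = x o ^ d o * ∏ i ∈ Finset.univ.erase o, twistedPow x o L i (d i) := by
  rw [twistedMonomial, ← Finset.mul_prod_erase _ _ (Finset.mem_univ o)]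
  simp [twistedPow, ho]

theorem pow_succ_dvd_twistedMonomial_sub (ho : o ∉ L) (d : ι → ℕ) :
    x o ^ (d o + 1) ∣ twistedMonomial x o L d - ∏ i, x i ^ d i := by
  rw [twistedMonomial_eq_mul ho, ← Finset.mul_prod_erase _ _ (Finset.mem_univ o), ← mul_sub,
    pow_succ]
  exact mul_dvd_mul_left _ (Finset.dvd_prod_sub_prod _ _ _ _ fun i _ =>
    dvd_twistedPow_sub_pow x o L i _)

theorem span_twistedMonomial {F : Type*} [Field F] [Algebra F A] {N : ℕ} (ho : o ∉ L)
    (hx : ∀ i, x i ^ N = 0)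
    (htop : Submodule.span F (Set.range fun d : ι → Fin N => ∏ i, x i ^ (d i : ℕ)) = ⊤) :
    Submodule.span F (Set.range fun d : ι → Fin N =>
      twistedMonomial x o L fun i => (d i : ℕ)) = ⊤ := by
  set W := Submodule.span F (Set.range fun d : ι → Fin N =>
      twistedMonomial x o L fun i => (d i : ℕ)) with hW
  have key : ∀ j k, k + j = N → ∀ a : A, x o ^ k * a ∈ W := by
    intro j
    induction j with
    | zero =>
      intro k hk a
      rw [show k = N by omega, hx]
      simp
    | succ j ih =>
      intro k hk a
      have ha : a ∈ Submodule.span F (Set.range fun d : ι → Fin N => ∏ i, x i ^ (d i : ℕ)) :=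
        htop ▸ Submodule.mem_top
      induction ha using Submodule.span_induction with
      | zero => simp
      | add a b _ _ ha hb => rw [mul_add]; exact W.add_mem ha hb
      | smul c a _ ha => rw [mul_smul_comm]; exact W.smul_mem c ha
      | mem a ha =>
        obtain ⟨d, rfl⟩ := ha
        by_cases hd : k + d o < N
        · have h1 : x o ^ k * ∏ i, x i ^ (d i : ℕ)
              = ∏ i, x i ^ (Function.update d o ⟨k + d o, hd⟩ i : ℕ) := by
            rw [← Finset.mul_prod_erase _ _ (Finset.mem_univ o),
              ← Finset.mul_prod_erase _ _ (Finset.mem_univ o), ← mul_assoc, ← pow_add]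
            congr 1
            · simp
            · refine Finset.prod_congr rfl fun i hi => ?_
              rw [Function.update_of_ne (Finset.ne_of_mem_erase hi)]
          obtain ⟨c, hc⟩ := pow_succ_dvd_twistedMonomial_sub (x := x) ho
            (fun i => (Function.update d o ⟨k + d o, hd⟩ i : ℕ))
          simp only [Function.update_self] at hc
          have h2 := ih (k + 1) (by omega) (x o ^ (d o : ℕ) * c)
          have h3 : twistedMonomial x o L (fun i => (Function.update d o ⟨k + d o, hd⟩ i : ℕ)) ∈ W :=
            Submodule.subset_span ⟨Function.update d o ⟨k + d o, hd⟩, rfl⟩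
          simp only at h1 ⊢
          rw [h1]
          convert W.sub_mem h3 h2 using 1
          rw [eq_sub_iff_add_eq, ← eq_sub_iff_add_eq', hc]
          ring
        · simp only
          rw [← Finset.mul_prod_erase _ _ (Finset.mem_univ o), ← mul_assoc, ← pow_add,
            show k + (d o : ℕ) = N + (k + d o - N) by omega, pow_add, hx]
          simp
  rw [eq_top_iff]
  intro a _
  simpa using key N 0 (by simp) a

variable {p : ℕ} [Fact p.Prime] [Algebra (ZMod p) A]

theorem map_twistedMonomial_of_dvd (ho : o ∉ L) (g : A →ₐ[ZMod p] A) {a : ι → ZMod p}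
    {ω : ZMod p} (hω : ω ≠ 0) (ha : ∀ i, i ∉ L → i ≠ o → a i = 0) (hgo : g (x o) = ω • x o)
    (hg : ∀ i, i ≠ o → g (x i) = x i + a i • x o) {d : ι → ℕ} (hd : ∀ i ∈ L, p ∣ d i) :
    g (twistedMonomial x o L d) = ω ^ d o • twistedMonomial x o L d := by
  rw [twistedMonomial_eq_mul ho, map_mul, map_pow, hgo, smul_pow, smul_mul_assoc, map_prod]
  congr 2
  refine Finset.prod_congr rfl fun i hi => ?_
  have hi' := Finset.ne_of_mem_erase hi
  unfold twistedPow
  split_ifs with hiL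
  · obtain ⟨b, hb⟩ := hd i hiL
    rw [map_fallingProd, hg i hi', hgo, hb, fallingProd_mul_char_affine _ _ _ _ hω]
  · rw [map_pow, hg i hi', ha i hiL hi']
    simp

theorem map_twistedMonomial_of_pow_succ_eq_zero (ho : o ∉ L) (g : A →ₐ[ZMod p] A) {a : ι → ZMod p}
    {ω : ZMod p} (hgo : g (x o) = ω • x o)
    (hg : ∀ i, i ≠ o → g (x i) = x i + a i • x o) {d : ι → ℕ} (hd : x o ^ (d o + 1) = 0) :
    g (twistedMonomial x o L d) = ω ^ d o • twistedMonomial x o L d := by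
  have h1 : twistedMonomial x o L d = ∏ i, x i ^ d i := by
    have := pow_succ_dvd_twistedMonomial_sub (x := x) ho d
    rwa [hd, zero_dvd_iff, sub_eq_zero] at this
  rw [h1, ← Finset.mul_prod_erase _ _ (Finset.mem_univ o), map_mul, map_pow, hgo, smul_pow,
    smul_mul_assoc, map_prod]
  congr 1
  have h2 : x o ∣ ∏ i ∈ Finset.univ.erase o, g (x i ^ d i) - ∏ i ∈ Finset.univ.erase o, x i ^ d i := by
    refine Finset.dvd_prod_sub_prod _ _ _ _ fun i hi => ?_
    rw [map_pow, hg i (Finset.ne_of_mem_erase hi)]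
    refine dvd_trans ?_ (sub_dvd_pow_sub_pow _ _ _)
    simpa using dvd_smul_of_dvd (a i) dvd_rfl
  obtain ⟨c, hc⟩ := h2
  rw [← sub_eq_zero, ← mul_sub, hc, ← mul_assoc, ← pow_succ, hd, zero_mul]

theorem map_twistedMonomial_sub_self {i : ι} (hi : i ∈ L) (ho : o ∉ L) (t : A →ₐ[ZMod p] A)
    (hti : t (x i) = x i + x o) (ht : ∀ j, j ≠ i → t (x j) = x j) (d : ι → ℕ) :
    t (twistedMonomial x o L d) - twistedMonomial x o L d
      = (d i : ZMod p) • twistedMonomial x o L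
          (Function.update (Function.update d o (d o + 1)) i (d i - 1)) := by
  have hio : o ≠ i := fun h => ho (h ▸ hi)
  have hoi : o ∈ Finset.univ.erase i := by simp [hio]
  have split : ∀ f : ι → ℕ, twistedMonomial x o L f = fallingProd (x i) (x o) (f i) *
      (x o ^ f o * ∏ j ∈ (Finset.univ.erase i).erase o, twistedPow x o L j (f j)) := by
    intro f
    rw [twistedMonomial, ← Finset.mul_prod_erase _ _ (Finset.mem_univ i),
      ← Finset.mul_prod_erase _ _ hoi]
    simp [twistedPow, ho, hi]
  have h1 : ∏ j ∈ (Finset.univ.erase i).erase o, twistedPow x o L j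
        (Function.update (Function.update d o (d o + 1)) i (d i - 1) j)
      = ∏ j ∈ (Finset.univ.erase i).erase o, twistedPow x o L j (d j) := by
    refine Finset.prod_congr rfl fun j hj => ?_
    simp only [Finset.mem_erase] at hj
    rw [Function.update_of_ne hj.2.1, Function.update_of_ne hj.1]
  have h2 : t (∏ j ∈ (Finset.univ.erase i).erase o, twistedPow x o L j (d j))
      = ∏ j ∈ (Finset.univ.erase i).erase o, twistedPow x o L j (d j) := by
    rw [map_prod]
    refine Finset.prod_congr rfl fun j hj => ?_
    simp only [Finset.mem_erase] at hj
    unfold twistedPow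
    split_ifs
    · rw [map_fallingProd, ht j hj.2.1, ht o hio]
    · rw [map_pow, ht j hj.2.1]
  rw [split, split, h1, Function.update_self, Function.update_of_ne hio, Function.update_self,
    map_mul, map_mul, h2, map_pow, ht o hio, map_fallingProd, hti, ht o hio,
    fallingProd_add, Nat.cast_smul_eq_nsmul, nsmul_eq_mul]
  ring

end basis

/-- If `T` sends each basis vector in the support of `a` to a multiple of a basis vector, and
distinct vectors with nonzero multiplier go to multiples of distinct vectors, then no vector with
nonzero multiplier occurs in an element of `ker T`. -/
theorem Module.Basis.repr_eq_zero_of_map_eq_zero {F M κ : Type*} [Field F] [AddCommGroup M]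
    [Module F M] [Fintype κ] (b : Module.Basis κ F M) (T : M →ₗ[F] M) (c : κ → F) (g : κ → κ)
    {a : M} (hT : ∀ d, b.repr a d ≠ 0 → T (b d) = c d • b (g d))
    (hg : ∀ d d', c d ≠ 0 → c d' ≠ 0 → g d = g d' → d = d') (ha : T a = 0) {d : κ}
    (hd : c d ≠ 0) : b.repr a d = 0 := by
  classical
  have h1 : ∑ k, (b.repr a k * c k) • b (g k) = 0 := by
    rw [← ha]
    conv_rhs => rw [← b.sum_repr a]
    rw [map_sum]
    refine Finset.sum_congr rfl fun k _ => ?_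
    rw [map_smul]
    by_cases hk : b.repr a k = 0
    · simp [hk]
    · rw [hT k hk, smul_smul]
  have h2 := congrArg (fun v => b.repr v (g d)) h1
  simp only [map_sum, map_smul, Module.Basis.repr_self, Finsupp.coe_finsetSum, Finset.sum_apply,
    Finsupp.smul_apply, Finsupp.single_apply, smul_eq_mul, map_zero, Finsupp.coe_zero,
    Pi.zero_apply] at h2
  rw [Finset.sum_eq_single d] at h2
  · simpa [hd] using h2
  · intro k _ hk
    by_cases hck : c k = 0
    · simp [hck]
    · rw [if_neg fun h => hk (hg k d hck hd h), mul_zero]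
  · simp


theorem Finset.card_filter_dvd_fin {k N : ℕ} (hk : 0 < k) (hN : k ∣ N) :
    (Finset.univ.filter fun j : Fin N => k ∣ (j : ℕ)).card = N / k := by
  obtain ⟨q, rfl⟩ := hN
  rw [Nat.mul_div_cancel_left _ hk]
  refine Eq.trans ?_ (Finset.card_range q)
  symm
  refine Finset.card_bij (fun r hr => ⟨k * r, Nat.mul_lt_mul_of_pos_left (Finset.mem_range.1 hr) hk⟩)
    ?_ ?_ ?_
  · simp
  · intro a _ b _ h
    simpa [hk.ne'] using h
  · rintro ⟨j, hj⟩ h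
    obtain ⟨r, rfl⟩ : k ∣ j := by simpa using h
    exact ⟨r, Finset.mem_range.2 (lt_of_mul_lt_mul_left hj (Nat.zero_le k)), rfl⟩

theorem Finset.card_filter_dvd_lt_fin {k N : ℕ} (hk : 0 < k) (hN : k ∣ N - 1) :
    (Finset.univ.filter fun j : Fin N => (j : ℕ) + 1 ≠ N ∧ k ∣ (j : ℕ)).card = (N - 1) / k := by
  rw [← Finset.card_filter_dvd_fin hk hN]
  symm
  refine Finset.card_bij (fun j _ => ⟨j, by omega⟩) ?_ ?_ ?_
  · rintro ⟨j, hj⟩ h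
    simp only [Finset.mem_filter, Finset.mem_univ, true_and] at h ⊢
    exact ⟨by omega, h⟩
  · intro a _ b _ h
    simpa [Fin.ext_iff] using h
  · rintro ⟨j, hj⟩ h
    simp only [Finset.mem_filter, Finset.mem_univ, true_and] at h
    exact ⟨⟨j, by omega⟩, by simpa using h.2, rfl⟩

theorem card_invariant_exponents {ι : Type*} [Fintype ι] [DecidableEq ι] {o : ι} {L : Finset ι}
    (ho : o ∉ L) {p e m : ℕ} (hp : 0 < p) (he : 0 < e) (hm : 1 ≤ m) (hep : e ∣ p ^ m - 1) :
    (Finset.univ.filter fun d : ι → Fin (p ^ m) =>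
      (d o : ℕ) + 1 = p ^ m ∨ e ∣ (d o : ℕ) ∧ ∀ i ∈ L, p ∣ (d i : ℕ)).card
      = p ^ (m * (Fintype.card ι - 1))
        + p ^ (m * (Fintype.card ι - 1) - L.card) * ((p ^ m - 1) / e) := by
  have hN : 0 < p ^ m := Nat.pow_pos hp
  set J₁ := Fintype.piFinset fun i : ι => if i = o then
    (Finset.univ.filter fun j : Fin (p ^ m) => (j : ℕ) + 1 = p ^ m) else Finset.univ with hJ₁
  set J₂ := Fintype.piFinset fun i : ι => if i = o then
    (Finset.univ.filter fun j : Fin (p ^ m) => (j : ℕ) + 1 ≠ p ^ m ∧ e ∣ (j : ℕ)) else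
    if i ∈ L then (Finset.univ.filter fun j : Fin (p ^ m) => p ∣ (j : ℕ)) else Finset.univ with hJ₂
  have m₁ : ∀ d, d ∈ J₁ ↔ (d o : ℕ) + 1 = p ^ m := by
    intro d
    rw [hJ₁, Fintype.mem_piFinset]
    refine ⟨fun h => by simpa using h o, fun h i => ?_⟩
    split_ifs with hi
    · subst hi; simpa using h
    · simp
  have m₂ : ∀ d, d ∈ J₂ ↔ ((d o : ℕ) + 1 ≠ p ^ m ∧ e ∣ (d o : ℕ)) ∧ ∀ i ∈ L, p ∣ (d i : ℕ) := by
    intro d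
    rw [hJ₂, Fintype.mem_piFinset]
    refine ⟨fun h => ⟨by simpa using h o, fun i hi => ?_⟩, fun h i => ?_⟩
    · have hio : i ≠ o := fun h => ho (h ▸ hi)
      simpa [hio, hi] using h i
    · split_ifs with hi hL
      · subst hi; simpa using h.1
      · simpa using h.2 i hL
      · simp
  have hU : (Finset.univ.filter fun d : ι → Fin (p ^ m) =>
      (d o : ℕ) + 1 = p ^ m ∨ e ∣ (d o : ℕ) ∧ ∀ i ∈ L, p ∣ (d i : ℕ)) = J₁ ∪ J₂ := by
    ext d
    simp only [Finset.mem_filter, Finset.mem_univ, true_and, Finset.mem_union, m₁, m₂]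
    tauto
  have hdis : Disjoint J₁ J₂ := Finset.disjoint_left.2 fun d h₁ h₂ =>
    ((m₂ d).1 h₂).1.1 ((m₁ d).1 h₁)
  have hcard : (Finset.univ.erase o).card = Fintype.card ι - 1 := by
    rw [Finset.card_erase_of_mem (Finset.mem_univ o), Finset.card_univ]
  have hLe : L ⊆ Finset.univ.erase o := fun i hi => by
    simpa using fun h : i = o => ho (h ▸ hi)
  have hLcard : L.card ≤ Fintype.card ι - 1 := hcard ▸ Finset.card_le_card hLe
  rw [hU, Finset.card_union_of_disjoint hdis]
  congr 1
  · rw [hJ₁, Fintype.card_piFinset, ← Finset.mul_prod_erase _ _ (Finset.mem_univ o), if_pos rfl]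
    have h1 : (Finset.univ.filter fun j : Fin (p ^ m) => (j : ℕ) + 1 = p ^ m).card = 1 := by
      rw [Finset.card_eq_one]
      refine ⟨⟨p ^ m - 1, by omega⟩, ?_⟩
      ext j
      simp only [Finset.mem_filter, Finset.mem_univ, true_and, Finset.mem_singleton, Fin.ext_iff]
      omega
    rw [h1, one_mul, Finset.prod_congr rfl fun i hi => by
      rw [if_neg (Finset.ne_of_mem_erase hi), Finset.card_univ, Fintype.card_fin],
      Finset.prod_const, hcard, ← pow_mul]
  · rw [hJ₂, Fintype.card_piFinset, ← Finset.mul_prod_erase _ _ (Finset.mem_univ o), if_pos rfl,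
      Finset.card_filter_dvd_lt_fin he hep, mul_comm]
    congr 1
    rw [← Finset.prod_sdiff hLe]
    have h1 : ∀ i ∈ L, (if i = o then
        (Finset.univ.filter fun j : Fin (p ^ m) => (j : ℕ) + 1 ≠ p ^ m ∧ e ∣ (j : ℕ)) else
        if i ∈ L then (Finset.univ.filter fun j : Fin (p ^ m) => p ∣ (j : ℕ))
        else Finset.univ).card = p ^ (m - 1) := by
      intro i hi
      rw [if_neg fun h : i = o => ho (h ▸ hi), if_pos hi,
        Finset.card_filter_dvd_fin hp (dvd_pow_self p (by omega))]
      refine Nat.div_eq_of_eq_mul_right hp ?_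
      rw [← pow_succ', Nat.sub_add_cancel hm]
    have h2 : ∀ i ∈ Finset.univ.erase o \ L, (if i = o then
        (Finset.univ.filter fun j : Fin (p ^ m) => (j : ℕ) + 1 ≠ p ^ m ∧ e ∣ (j : ℕ)) else
        if i ∈ L then (Finset.univ.filter fun j : Fin (p ^ m) => p ∣ (j : ℕ))
        else Finset.univ).card = p ^ m := by
      intro i hi
      rw [Finset.mem_sdiff] at hi
      rw [if_neg (Finset.ne_of_mem_erase hi.1), if_neg hi.2, Finset.card_univ, Fintype.card_fin]
    rw [Finset.prod_congr rfl h1, Finset.prod_congr rfl h2, Finset.prod_const, Finset.prod_const,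
      Finset.card_sdiff_of_subset hLe, hcard, ← pow_mul, ← pow_mul, ← pow_add]
    congr 1
    obtain ⟨c, hc⟩ := Nat.exists_eq_add_of_le hLcard
    obtain ⟨m', rfl⟩ := Nat.exists_eq_add_of_le hm
    rw [hc, Nat.add_sub_cancel_left, Nat.add_sub_cancel_left, eq_comm, Nat.sub_eq_iff_eq_add]
    · ring
    · nlinarith [Nat.zero_le (m' * (L.card + c))]

/-- The invariants of a set of affine reflections, containing enough transvections and a semisimple
reflection of order `e`, acting on an algebra with basis the monomials `∏ i, x i ^ d i`,
`d i < p ^ m`. -/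
theorem finrank_fixed_of_truncated {p : ℕ} [Fact p.Prime] {A : Type*} [CommRing A]
    [Algebra (ZMod p) A] {ι : Type*} [Fintype ι] [DecidableEq ι] {x : ι → A} {o : ι}
    {L : Finset ι} (ho : o ∉ L) {m e : ℕ} (hm : 1 ≤ m) (hx : ∀ i, x i ^ p ^ m = 0)
    (htop : Submodule.span (ZMod p)
      (Set.range fun d : ι → Fin (p ^ m) => ∏ i, x i ^ (d i : ℕ)) = ⊤)
    (hdim : Module.finrank (ZMod p) A = (p ^ m) ^ Fintype.card ι)
    (Γ : Set (A →ₐ[ZMod p] A))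
    (hΓ : ∀ g ∈ Γ, ∃ (a : ι → ZMod p) (ω : ZMod p), ω ≠ 0 ∧ ω ^ e = 1 ∧
      (∀ i, i ∉ L → i ≠ o → a i = 0) ∧ g (x o) = ω • x o ∧
      ∀ i, i ≠ o → g (x i) = x i + a i • x o)
    (ht : ∀ i ∈ L, ∃ t ∈ Γ, t (x i) = x i + x o ∧ ∀ j, j ≠ i → t (x j) = x j)
    (hs : ∃ s ∈ Γ, ∃ ω : ZMod p, ω ≠ 0 ∧ orderOf ω = e ∧ s (x o) = ω • x o ∧
      ∀ j, j ≠ o → s (x j) = x j)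
    (K : Submodule (ZMod p) A) (hK : ∀ a, a ∈ K ↔ ∀ g ∈ Γ, g a = a) :
    Module.finrank (ZMod p) K = p ^ (m * (Fintype.card ι - 1))
        + p ^ (m * (Fintype.card ι - 1) - L.card) * ((p ^ m - 1) / e) := by
  have hp : p.Prime := Fact.out
  obtain ⟨s, hsΓ, ω, hω, hωe, hso, hsx⟩ := hs
  have hep : e ∣ p ^ m - 1 := by
    refine dvd_trans ?_ (Nat.sub_one_dvd_pow_sub_one p m)
    rw [← hωe]
    exact orderOf_dvd_of_pow_eq_one (ZMod.pow_card_sub_one_eq_one hω)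
  have he : 0 < e := Nat.pos_of_dvd_of_pos hep
    (Nat.sub_pos_of_lt (Nat.one_lt_pow (by omega) hp.one_lt))
  let b : Module.Basis (ι → Fin (p ^ m)) (ZMod p) A := basisOfTopLeSpanOfCardEqFinrank
    (fun d => twistedMonomial x o L fun i => (d i : ℕ))
    (span_twistedMonomial ho hx htop).ge (by rw [hdim]; simp)
  have hb : ∀ d, b d = twistedMonomial x o L fun i => (d i : ℕ) := fun d => by
    simp [b]
  set J := Finset.univ.filter fun d : ι → Fin (p ^ m) =>
      (d o : ℕ) + 1 = p ^ m ∨ e ∣ (d o : ℕ) ∧ ∀ i ∈ L, p ∣ (d i : ℕ) with hJ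
  have htop_zero : ∀ d : ι → Fin (p ^ m), (d o : ℕ) + 1 = p ^ m → x o ^ ((d o : ℕ) + 1) = 0 :=
    fun d hd => by rw [hd, hx]
  have hKJ : K = Submodule.span (ZMod p) (b '' (J : Set (ι → Fin (p ^ m)))) := by
    refine le_antisymm (fun a ha => ?_) (Submodule.span_le.2 ?_)
    · rw [hK] at ha
      have supp_t : ∀ d, b.repr a d ≠ 0 → (d o : ℕ) + 1 = p ^ m ∨ ∀ i ∈ L, p ∣ (d i : ℕ) := by
        intro d hd
        by_contra! hcon
        obtain ⟨hdo, i, hi, hpi⟩ := hcon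
        have hio : o ≠ i := fun h => ho (h ▸ hi)
        obtain ⟨t, htΓ, hti, htj⟩ := ht i hi
        refine hd (b.repr_eq_zero_of_map_eq_zero (t.toLinearMap - LinearMap.id)
          (fun d => if (d o : ℕ) + 1 = p ^ m then 0 else ((d i : ℕ) : ZMod p))
          (fun d => if h : (d o : ℕ) + 1 = p ^ m then d else Function.update
            (Function.update d o ⟨d o + 1, by omega⟩) i ⟨d i - 1, by omega⟩) ?_ ?_ ?_ ?_)
        · intro d _
          rw [hb, LinearMap.sub_apply, AlgHom.toLinearMap_apply, LinearMap.id_apply]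
          by_cases h : (d o : ℕ) + 1 = p ^ m
          · rw [if_pos h, zero_smul, map_twistedMonomial_of_pow_succ_eq_zero (ω := 1)
              (a := fun j => if j = i then 1 else 0) ho t (by simp [htj o hio]) ?_ (htop_zero d h)]
            · simp
            · intro j _
              by_cases hj : j = i
              · subst hj; simp [hti]
              · simp [hj, htj j hj]
          · rw [if_neg h, dif_neg h, hb, map_twistedMonomial_sub_self hi ho t hti htj]
            congr 2
            funext j
            by_cases hj : j = i
            · subst hj; simp
            · by_cases hjo : j = o
              · subst hjo; simp [hj]
              · simp [hj, hjo]
        · intro d d' hd hd' h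
          simp only [ne_eq, ite_eq_left_iff, Classical.not_imp, ZMod.natCast_eq_zero_iff] at hd hd'
          rw [dif_neg hd.1, dif_neg hd'.1] at h
          have h0 : (d i : ℕ) ≠ 0 := fun h => hd.2 (h ▸ dvd_zero p)
          have h0' : (d' i : ℕ) ≠ 0 := fun h => hd'.2 (h ▸ dvd_zero p)
          funext j
          have hj' := congrArg (fun f => (f j : ℕ)) h
          by_cases hj : j = i
          · subst hj
            simp only [Function.update_self] at hj'
            exact Fin.ext (by omega)
          · by_cases hjo : j = o
            · subst hjo
              simp only [Function.update_of_ne hj, Function.update_self] at hj'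
              exact Fin.ext (by omega)
            · simp only [Function.update_of_ne hj, Function.update_of_ne hjo] at hj'
              exact Fin.ext hj'
        · simp [ha t htΓ]
        · simpa [hdo, ZMod.natCast_eq_zero_iff] using hpi
      rw [b.mem_span_image]
      intro d hd
      have hd' : b.repr a d ≠ 0 := by simpa using hd
      have hdt := supp_t d hd'
      by_contra hdJ
      have hdJ' : ¬ ((d o : ℕ) + 1 = p ^ m ∨ e ∣ (d o : ℕ) ∧ ∀ i ∈ L, p ∣ (d i : ℕ)) := by
        simpa [hJ] using hdJ
      refine hd' (b.repr_eq_zero_of_map_eq_zero (s.toLinearMap - LinearMap.id)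
          (fun d => ω ^ (d o : ℕ) - 1) id ?_ (fun _ _ _ _ h => h) ?_ ?_)
      · intro d hd
        rw [hb, LinearMap.sub_apply, AlgHom.toLinearMap_apply, LinearMap.id_apply, sub_smul,
          one_smul, id, hb]
        congr 1
        rcases supp_t d hd with h | h
        · exact map_twistedMonomial_of_pow_succ_eq_zero (a := 0) ho s hso
            (fun j hj => by simp [hsx j hj]) (htop_zero d h)
        · exact map_twistedMonomial_of_dvd (a := 0) ho s hω (by simp) hso
            (fun j hj => by simp [hsx j hj]) h
      · simp [ha s hsΓ]
      · rw [sub_ne_zero]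
        intro h
        have := orderOf_dvd_of_pow_eq_one h
        rw [hωe] at this
        tauto
    · rintro _ ⟨d, hd, rfl⟩
      rw [SetLike.mem_coe, hK]
      intro g hg
      obtain ⟨a, ω', hω', hωe', haL, hgo, hgx⟩ := hΓ g hg
      have hd' : (d o : ℕ) + 1 = p ^ m ∨ e ∣ (d o : ℕ) ∧ ∀ i ∈ L, p ∣ (d i : ℕ) := by
        simpa [hJ] using hd
      have hedvd : e ∣ (d o : ℕ) := by
        rcases hd' with h | h
        · rwa [← h, Nat.add_sub_cancel] at hep
        · exact h.1
      have h1 : ω' ^ (d o : ℕ) = 1 := by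
        obtain ⟨c, hc⟩ := hedvd
        rw [hc, pow_mul, hωe', one_pow]
      rw [hb]
      rcases hd' with h | h
      · rw [map_twistedMonomial_of_pow_succ_eq_zero ho g hgo hgx (htop_zero d h), h1, one_smul]
      · rw [map_twistedMonomial_of_dvd ho g hω' haL hgo hgx h.2, h1, one_smul]
  rw [← card_invariant_exponents ho hp.pos he hm hep, hKJ, Set.image_eq_range]
  refine (finrank_span_eq_card (b.linearIndependent.comp _ Subtype.val_injective)).trans ?_
  rw [← hJ, ← Fintype.card_coe]
  rfl


section frobIdeal

variable {F : Type} [Field F] {n : ℕ}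

theorem mem_frobIdeal_iff {N : ℕ} (f : MvPolynomial (Fin n) F) :
    f ∈ frobIdeal F n N ↔ ∀ d ∈ f.support, ∃ i, N ≤ d i := by
  have h : frobIdeal F n N = Ideal.span ((fun s => monomial s (1 : F)) ''
      Set.range fun i : Fin n => Finsupp.single i N) := by
    rw [frobIdeal, ← Set.range_comp]
    congr 2
    funext i
    simp [X_pow_eq_monomial]
  rw [h, mem_ideal_span_monomial_image]
  simp

theorem finrank_quotient_frobIdeal (N : ℕ) :
    Module.finrank F (MvPolynomial (Fin n) F ⧸ frobIdeal F n N) = N ^ n := by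
  let c : MvPolynomial (Fin n) F →ₗ[F] ((Fin n → Fin N) → F) :=
    LinearMap.pi fun d => lcoeff F (Finsupp.equivFunOnFinite.symm fun i => (d i : ℕ))
  have hinj : Function.Injective fun d : Fin n → Fin N =>
      Finsupp.equivFunOnFinite.symm fun i => (d i : ℕ) := by
    intro d d' h
    funext i
    exact Fin.ext (congrFun (Finsupp.equivFunOnFinite.symm.injective h) i)
  have hc : Function.Surjective c := by
    intro v
    refine ⟨∑ d, monomial (Finsupp.equivFunOnFinite.symm fun i => (d i : ℕ)) (v d), ?_⟩
    funext d
    simp only [c, LinearMap.pi_apply, lcoeff_apply, coeff_sum, coeff_monomial]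
    rw [Finset.sum_eq_single d]
    · simp
    · intro d' _ hd'
      rw [if_neg fun h => hd' (hinj h)]
    · simp
  let q : MvPolynomial (Fin n) F →ₗ[F] MvPolynomial (Fin n) F ⧸ frobIdeal F n N :=
    (Ideal.Quotient.mkₐ F (frobIdeal F n N)).toLinearMap
  have hq : Function.Surjective q := Ideal.Quotient.mkₐ_surjective F (frobIdeal F n N)
  have hker : LinearMap.ker q = LinearMap.ker c := by
    ext f
    rw [LinearMap.mem_ker, LinearMap.mem_ker, AlgHom.toLinearMap_apply, Ideal.Quotient.mkₐ_eq_mk,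
      Ideal.Quotient.eq_zero_iff_mem, mem_frobIdeal_iff]
    constructor
    · intro h
      funext d
      by_contra hd
      obtain ⟨i, hi⟩ := h _ (mem_support_iff.2 hd)
      exact absurd (d i).2 (not_lt.2 hi)
    · intro h d hd
      by_contra! hcon
      refine mem_support_iff.1 hd ?_
      have := congrFun h fun i => (⟨d i, hcon i⟩ : Fin N)
      simpa [c, lcoeff_apply] using this
  have e := (q.quotKerEquivOfSurjective hq).symm ≪≫ₗ Submodule.quotEquivOfEq _ _ hker ≪≫ₗ
    c.quotKerEquivOfSurjective hc
  rw [e.finrank_eq]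
  simp

/-- A linear functional on `F^n`, as a homogeneous polynomial of degree one. -/
noncomputable def linForm : ((Fin n → F) →ₗ[F] F) →ₗ[F] MvPolynomial (Fin n) F where
  toFun φ := ∑ j, φ (Pi.single j 1) • X j
  map_add' φ ψ := by simp [add_smul, Finset.sum_add_distrib]
  map_smul' c φ := by simp [mul_smul, Finset.smul_sum]

theorem linForm_apply (φ : (Fin n → F) →ₗ[F] F) : linForm φ = ∑ j, φ (Pi.single j 1) • X j := rfl

theorem linForm_proj (j : Fin n) : linForm (LinearMap.proj j : (Fin n → F) →ₗ[F] F) = X j := by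
  rw [linForm_apply, Finset.sum_eq_single j]
  · simp
  · intro k _ hk
    simp [hk.symm]
  · simp

theorem gSub_linForm (g : GL (Fin n) F) (φ : (Fin n → F) →ₗ[F] F) :
    gSub g (linForm φ)
      = linForm (φ ∘ₗ Matrix.toLin' (g : Matrix (Fin n) (Fin n) F)) := by
  have hφ : ∀ k, φ ((g : Matrix (Fin n) (Fin n) F) *ᵥ Pi.single k 1)
      = ∑ j, φ (Pi.single j 1) * (g : Matrix (Fin n) (Fin n) F) j k := by
    intro k
    rw [Matrix.mulVec_single_one, LinearMap.pi_apply_eq_sum_univ φ]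
    refine Finset.sum_congr rfl fun j _ => ?_
    rw [smul_eq_mul, mul_comm]
    congr 2
    funext i
    simp [Pi.single_apply, eq_comm]
  rw [linForm_apply, linForm_apply, map_sum]
  simp only [map_smul, gSub, aeval_X, LinearMap.comp_apply, Matrix.toLin'_apply, hφ,
    Finset.smul_sum, Finset.sum_smul, C_mul', smul_smul]
  exact Finset.sum_comm

theorem linForm_pow_mem_frobIdeal {p : ℕ} [Fact p.Prime] [CharP F p] (m : ℕ)
    (φ : (Fin n → F) →ₗ[F] F) : linForm φ ^ p ^ m ∈ frobIdeal F n (p ^ m) := by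
  rw [linForm_apply, sum_pow_char_pow]
  refine Ideal.sum_mem _ fun j _ => ?_
  rw [smul_pow, smul_eq_C_mul]
  exact Ideal.mul_mem_left _ _ (Ideal.subset_span ⟨j, rfl⟩)

theorem frobIdeal_le_comap_gSub {p : ℕ} [Fact p.Prime] [CharP F p] (m : ℕ) (g : GL (Fin n) F) :
    frobIdeal F n (p ^ m) ≤ (frobIdeal F n (p ^ m)).comap (gSub g) := by
  refine Ideal.span_le.2 ?_
  rintro _ ⟨i, rfl⟩
  rw [SetLike.mem_coe, Ideal.mem_comap, map_pow, ← linForm_proj, gSub_linForm]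
  exact linForm_pow_mem_frobIdeal m _

/-- The action of `g ∈ GL_n(F)` on the truncated polynomial ring. -/
noncomputable def gQuot {p : ℕ} [Fact p.Prime] [CharP F p] (m : ℕ) (g : GL (Fin n) F) :
    (MvPolynomial (Fin n) F ⧸ frobIdeal F n (p ^ m)) →ₐ[F]
      (MvPolynomial (Fin n) F ⧸ frobIdeal F n (p ^ m)) :=
  Ideal.quotientMapₐ _ (gSub g) (frobIdeal_le_comap_gSub m g)

theorem gQuot_mk {p : ℕ} [Fact p.Prime] [CharP F p] (m : ℕ) (g : GL (Fin n) F)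
    (f : MvPolynomial (Fin n) F) :
    gQuot m g (Ideal.Quotient.mkₐ F (frobIdeal F n (p ^ m)) f)
      = Ideal.Quotient.mkₐ F (frobIdeal F n (p ^ m)) (gSub g f) := rfl

theorem mem_invQuot_iff {p : ℕ} [Fact p.Prime] [CharP F p] (m : ℕ) (G : Subgroup (GL (Fin n) F))
    (a : MvPolynomial (Fin n) F ⧸ frobIdeal F n (p ^ m)) :
    a ∈ invQuot G (p ^ m) ↔ ∀ g ∈ G, gQuot m g a = a := by
  have h : ∀ f, f ∈ invLift G (p ^ m) ↔ ∀ g ∈ G,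
      gQuot m g (Ideal.Quotient.mkₐ F (frobIdeal F n (p ^ m)) f)
        = Ideal.Quotient.mkₐ F (frobIdeal F n (p ^ m)) f := by
    intro f
    simp only [gQuot_mk]
    simp only [Ideal.Quotient.mkₐ_eq_mk, Ideal.Quotient.eq]
    simp only [invLift, Submodule.mem_iInf, Submodule.mem_comap, LinearMap.sub_apply, AlgHom.toLinearMap_apply,
      LinearMap.id_apply, Submodule.restrictScalars_mem]
  constructor
  · rintro ⟨f, hf, rfl⟩
    exact (h f).1 hf
  · obtain ⟨f, rfl⟩ := Ideal.Quotient.mkₐ_surjective F (frobIdeal F n (p ^ m)) a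
    exact fun ha => ⟨f, (h f).2 ha, rfl⟩

theorem span_truncated_monomials {A ι : Type*} [CommRing A] [Algebra F A] [Fintype ι] {N : ℕ}
    {x : ι → A} (hx : ∀ i, x i ^ N = 0)
    (hsurj : Function.Surjective (aeval x : MvPolynomial ι F →ₐ[F] A)) :
    Submodule.span F (Set.range fun d : ι → Fin N => ∏ i, x i ^ (d i : ℕ)) = ⊤ := by
  rw [eq_top_iff]
  intro a _
  obtain ⟨f, rfl⟩ := hsurj a
  rw [aeval_def, eval₂_eq']
  refine Submodule.sum_mem _ fun d _ => ?_
  rw [← Algebra.smul_def]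
  refine Submodule.smul_mem _ _ ?_
  by_cases h : ∀ i, d i < N
  · exact Submodule.subset_span ⟨fun i => ⟨d i, h i⟩, rfl⟩
  · push Not at h
    obtain ⟨i, hi⟩ := h
    have h0 : ∏ i, x i ^ d i = 0 :=
      Finset.prod_eq_zero (Finset.mem_univ i) (pow_eq_zero_of_le hi (hx i))
    exact h0 ▸ Submodule.zero_mem _

theorem aeval_linForm_coord_surjective {ι : Type*} [Fintype ι] (B : Module.Basis ι F (Fin n → F))
    (I : Ideal (MvPolynomial (Fin n) F)) :
    Function.Surjective
      (aeval fun i => Ideal.Quotient.mkₐ F I (linForm (B.coord i)) :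
        MvPolynomial ι F →ₐ[F] MvPolynomial (Fin n) F ⧸ I) := by
  rw [← AlgHom.range_eq_top, eq_top_iff]
  rintro a -
  obtain ⟨f, rfl⟩ := Ideal.Quotient.mkₐ_surjective F I a
  have hX : ∀ j, Ideal.Quotient.mkₐ F I (X j) ∈
      (aeval fun i => Ideal.Quotient.mkₐ F I (linForm (B.coord i)) :
        MvPolynomial ι F →ₐ[F] MvPolynomial (Fin n) F ⧸ I).range := by
    intro j
    have hj : (LinearMap.proj j : (Fin n → F) →ₗ[F] F) = ∑ i, B i j • B.coord i := by
      refine B.ext fun k => ?_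
      classical
      simp [LinearMap.sum_apply, Finsupp.single_apply]
    rw [← linForm_proj, hj, map_sum, map_sum]
    refine Subalgebra.sum_mem _ fun i _ => ?_
    rw [map_smul, map_smul]
    exact Subalgebra.smul_mem _ ((AlgHom.mem_range _).2 ⟨X i, aeval_X _ i⟩) _
  induction f using MvPolynomial.induction_on with
  | C c =>
    rw [← algebraMap_eq, AlgHom.commutes]
    exact Subalgebra.algebraMap_mem _ c
  | add f g hf hg => rw [map_add]; exact Subalgebra.add_mem _ hf hg
  | mul_X f j hf => rw [map_mul]; exact Subalgebra.mul_mem _ hf (hX j)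

end frobIdeal

section hyperplane

variable {F : Type} [Field F] {n : ℕ} {l : (Fin n → F) →ₗ[F] F}

theorem mulVec_eq_add_of_fixes_hyperplane {M : Matrix (Fin n) (Fin n) F}
    (hM : ∀ v, l v = 0 → M *ᵥ v = v) {u : Fin n → F} (hu : l u = 1) (v : Fin n → F) :
    M *ᵥ v = v + l v • (M *ᵥ u - u) := by
  have h := hM (v - l v • u) (by simp [hu])
  rw [Matrix.mulVec_sub, Matrix.mulVec_smul] at h
  rw [smul_sub, ← sub_eq_zero, ← sub_eq_zero.2 h]
  abel

theorem isSemisimple_of_reflection {M : Matrix (Fin n) (Fin n) F} {α : Fin n → F}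
    (hM : ∀ v, M *ᵥ v = v + l v • α) (hα : l α ≠ 0) :
    Module.End.IsSemisimple (Matrix.toLin' M) := by
  refine Module.End.isSemisimple_of_squarefree_aeval_eq_zero
    (p := (Polynomial.X - Polynomial.C 1) * (Polynomial.X - Polynomial.C (1 + l α))) ?_ ?_
  · refine Polynomial.Separable.squarefree ?_
    refine (Polynomial.separable_X_sub_C).mul Polynomial.separable_X_sub_C ?_
    exact Polynomial.isCoprime_X_sub_C_of_isUnit_sub (by simpa using hα)
  · refine LinearMap.ext fun v => ?_
    simp only [map_mul, map_sub, Polynomial.aeval_X, Polynomial.aeval_C, 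
      Module.End.mul_apply, LinearMap.sub_apply, Matrix.toLin'_apply, hM,
      Module.algebraMap_end_apply, LinearMap.zero_apply]
    simp only [map_add, map_smul, smul_eq_mul, add_sub_cancel_left, one_smul]
    rw [sub_eq_zero]
    congr 1
    ring

theorem eq_one_of_isSemisimple_of_transvection [PerfectField F] {g : GL (Fin n) F} {α : Fin n → F}
    (hg : ∀ v, (g : Matrix (Fin n) (Fin n) F) *ᵥ v = v + l v • α) (hα : l α = 0)
    (hss : Module.End.IsSemisimple (Matrix.toLin' (g : Matrix (Fin n) (Fin n) F))) : g = 1 := by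
  set T := Matrix.toLin' (g : Matrix (Fin n) (Fin n) F) with hT
  have hnil : IsNilpotent (T - 1) := by
    refine ⟨2, LinearMap.ext fun v => ?_⟩
    simp [pow_two, hT, hg, hα]
  have hss' : Module.End.IsSemisimple (T - 1) :=
    Module.End.IsSemisimple.sub_of_commute (Commute.one_right T) hss Module.End.isSemisimple_id
  have h0 := Module.End.eq_zero_of_isNilpotent_isSemisimple hnil hss'
  refine Units.ext (Matrix.toLin'.injective ?_)
  rw [Units.val_one, Matrix.toLin'_one, ← hT, sub_eq_zero.1 h0]
  rfl

theorem exists_pow_mulVec_eq {g : GL (Fin n) F} {α : Fin n → F}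
    (hg : ∀ v, (g : Matrix (Fin n) (Fin n) F) *ᵥ v = v + l v • α) (k : ℕ) :
    ∃ s : F, ∀ v, ((g ^ k : GL (Fin n) F) : Matrix (Fin n) (Fin n) F) *ᵥ v
      = v + l v • s • α := by
  induction k with
  | zero => exact ⟨0, by simp⟩
  | succ k ih =>
    obtain ⟨s, hs⟩ := ih
    refine ⟨1 + (1 + l α) * s, fun v => ?_⟩
    rw [pow_succ, Units.val_mul, ← Matrix.mulVec_mulVec, hg, hs, map_add, map_smul]
    module

/-- The character by which a group fixing the kernel of `l` pointwise acts modulo that kernel. -/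
noncomputable def hyperplaneChar (G : Subgroup (GL (Fin n) F)) (l : (Fin n → F) →ₗ[F] F)
    (hfix : ∀ g ∈ G, ∀ v, l v = 0 → (g : Matrix (Fin n) (Fin n) F) *ᵥ v = v)
    {u : Fin n → F} (hu : l u = 1) : G →* F where
  toFun g := l (((g : GL (Fin n) F) : Matrix (Fin n) (Fin n) F) *ᵥ u)
  map_one' := by simp [hu]
  map_mul' g h := by
    rw [Subgroup.coe_mul, Units.val_mul, ← Matrix.mulVec_mulVec,
      mulVec_eq_add_of_fixes_hyperplane (hfix g g.2) hu, map_add, map_smul, map_sub, hu,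
      smul_eq_mul]
    ring

variable {G : Subgroup (GL (Fin n) F)}
  {hfix : ∀ g ∈ G, ∀ v, l v = 0 → (g : Matrix (Fin n) (Fin n) F) *ᵥ v = v}
  {u : Fin n → F} {hu : l u = 1}

theorem hyperplaneChar_eq {g : G} {α : Fin n → F}
    (hg : ∀ v, ((g : GL (Fin n) F) : Matrix (Fin n) (Fin n) F) *ᵥ v = v + l v • α) :
    hyperplaneChar G l hfix hu g = 1 + l α := by
  simp [hyperplaneChar, hg, hu]

theorem hyperplaneChar_ne_zero (g : G) : hyperplaneChar G l hfix hu g ≠ 0 :=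
  ((Group.isUnit g).map (hyperplaneChar G l hfix hu)).ne_zero

theorem orderOf_hyperplaneChar_of_isSemisimple [PerfectField F] (g : G)
    (hss : Module.End.IsSemisimple (Matrix.toLin' ((g : GL (Fin n) F) : Matrix (Fin n) (Fin n) F))) :
    orderOf (hyperplaneChar G l hfix hu g) = orderOf (g : GL (Fin n) F) := by
  have hg := mulVec_eq_add_of_fixes_hyperplane (hfix g g.2) hu
  set α := ((g : GL (Fin n) F) : Matrix (Fin n) (Fin n) F) *ᵥ u - u
  by_cases hα : l α = 0
  · rw [hyperplaneChar_eq hg, eq_one_of_isSemisimple_of_transvection hg hα hss]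
    simp [hα]
  · rw [orderOf_eq_orderOf_iff]
    intro k
    rw [← map_pow]
    obtain ⟨s, hs⟩ := exists_pow_mulVec_eq hg k
    rw [hyperplaneChar_eq (g := g ^ k) (α := s • α) (by simpa using hs)]
    constructor
    · intro h
      have hs0 : s = 0 := by simpa [hα] using h
      refine Units.ext (Matrix.ext_of_mulVec_single fun j => ?_)
      rw [hs, hs0, zero_smul, smul_zero, add_zero, Units.val_one, Matrix.one_mulVec]
    · intro h
      have h1 := hs u
      rw [h] at h1
      have h2 : s • α = 0 := by simpa [hu] using h1
      rw [h2]
      simp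

theorem exists_isSemisimple_hyperplaneChar_eq (g : G) :
    ∃ g' : G, Module.End.IsSemisimple
      (Matrix.toLin' ((g' : GL (Fin n) F) : Matrix (Fin n) (Fin n) F)) ∧
      hyperplaneChar G l hfix hu g' = hyperplaneChar G l hfix hu g := by
  have hg := mulVec_eq_add_of_fixes_hyperplane (hfix g g.2) hu
  by_cases hα : l (((g : GL (Fin n) F) : Matrix (Fin n) (Fin n) F) *ᵥ u - u) = 0
  · refine ⟨1, ?_, ?_⟩
    · rw [Subgroup.coe_one, Units.val_one, Matrix.toLin'_one]
      exact Module.End.isSemisimple_id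
    · rw [map_one, hyperplaneChar_eq hg, hα, add_zero]
  · exact ⟨g, isSemisimple_of_reflection hg hα, rfl⟩

theorem hyperplaneChar_pow_eq_one [Finite F] {e : ℕ}
    (he : IsGreatest {k | ∃ g ∈ G, Module.End.IsSemisimple
      (Matrix.toLin' (g : Matrix (Fin n) (Fin n) F)) ∧ orderOf g = k} e) (g : G) :
    hyperplaneChar G l hfix hu g ^ e = 1 := by
  set χ := hyperplaneChar G l hfix hu
  have hord : ∀ g : G, orderOf (χ.toHomUnits g) = orderOf (χ g) := fun g => by
    rw [← orderOf_units]
    rfl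
  obtain ⟨⟨_, g₁, rfl⟩, hg₁⟩ := Monoid.exists_orderOf_eq_exponent
    (Monoid.ExponentExists.of_finite (G := χ.toHomUnits.range))
  have hexp : ∀ g : G, χ g ^ Monoid.exponent χ.toHomUnits.range = 1 := fun g => by
    have := Monoid.pow_exponent_eq_one (⟨_, g, rfl⟩ : χ.toHomUnits.range)
    simpa [Subtype.ext_iff, Units.ext_iff] using this
  replace hg₁ : orderOf (χ g₁) = Monoid.exponent χ.toHomUnits.range := by
    rw [← hg₁, ← hord, ← Subgroup.orderOf_coe]
  obtain ⟨g₂, hss₂, hχ₂⟩ := exists_isSemisimple_hyperplaneChar_eq (hfix := hfix) (hu := hu) g₁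
  obtain ⟨g₀, hg₀, hss₀, he₀⟩ := he.1
  have h1 : Monoid.exponent χ.toHomUnits.range ≤ e := by
    refine he.2 ⟨g₂, g₂.2, hss₂, ?_⟩
    rw [← orderOf_hyperplaneChar_of_isSemisimple (hfix := hfix) (hu := hu) g₂ hss₂, hχ₂, hg₁]
  have h2 : e ∣ Monoid.exponent χ.toHomUnits.range := by
    rw [← he₀, ← orderOf_hyperplaneChar_of_isSemisimple (hfix := hfix) (hu := hu) ⟨g₀, hg₀⟩ hss₀]
    exact orderOf_dvd_of_pow_eq_one (hexp _)
  have h3 : 0 < Monoid.exponent χ.toHomUnits.range :=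
    Monoid.ExponentExists.exponent_pos Monoid.ExponentExists.of_finite
  rw [le_antisymm (Nat.le_of_dvd h3 h2) h1]
  exact hexp g

/-- A semisimple element of maximal order determines a complement `b` of the hyperplane modulo
which every root is a root of a transvection. -/
theorem exists_hyperplane_complement [Finite F] {e : ℕ}
    (hfix : ∀ g ∈ G, ∀ v, l v = 0 → (g : Matrix (Fin n) (Fin n) F) *ᵥ v = v)
    (hu : l u = 1)
    (he : IsGreatest {k | ∃ g ∈ G, Module.End.IsSemisimple
      (Matrix.toLin' (g : Matrix (Fin n) (Fin n) F)) ∧ orderOf g = k} e) :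
    ∃ b : Fin n → F, l b = 1 ∧
      (∃ g ∈ G, ∃ ω : F, ω ≠ 0 ∧ orderOf ω = e ∧
        ∀ v, (g : Matrix (Fin n) (Fin n) F) *ᵥ v = v + l v • (ω - 1) • b) ∧
      ∀ g ∈ G, ∃ α : Fin n → F, ∃ ω : F, ω ≠ 0 ∧ ω ^ e = 1 ∧ l α = 0 ∧
        (∃ h ∈ G, ∀ v, (h : Matrix (Fin n) (Fin n) F) *ᵥ v = v + l v • α) ∧
        ∀ v, (g : Matrix (Fin n) (Fin n) F) *ᵥ v = v + l v • (α + (ω - 1) • b) := by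
  obtain ⟨g₀, hg₀, hss₀, he₀⟩ := he.1
  set χ := hyperplaneChar G l hfix hu with hχ
  set ω₀ := χ ⟨g₀, hg₀⟩ with hω₀
  have hord : orderOf ω₀ = e := by
    rw [← he₀, ← orderOf_hyperplaneChar_of_isSemisimple (hfix := hfix) (hu := hu) ⟨g₀, hg₀⟩ hss₀]
  have hroot := mulVec_eq_add_of_fixes_hyperplane (hfix g₀ hg₀) hu
  have hω₀α : ω₀ = 1 + l ((g₀ : Matrix (Fin n) (Fin n) F) *ᵥ u - u) :=
    hyperplaneChar_eq (g := ⟨g₀, hg₀⟩) hroot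
  obtain ⟨b, hb, hgb⟩ : ∃ b : Fin n → F, l b = 1 ∧
      ∀ v, (g₀ : Matrix (Fin n) (Fin n) F) *ᵥ v = v + l v • (ω₀ - 1) • b := by
    by_cases hα : l ((g₀ : Matrix (Fin n) (Fin n) F) *ᵥ u - u) = 0
    · have h1 := eq_one_of_isSemisimple_of_transvection hroot hα hss₀
      refine ⟨u, hu, fun v => ?_⟩
      rw [hω₀α, hα, h1]
      simp
    · refine ⟨(l ((g₀ : Matrix (Fin n) (Fin n) F) *ᵥ u - u))⁻¹ •
        ((g₀ : Matrix (Fin n) (Fin n) F) *ᵥ u - u), ?_, fun v => ?_⟩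
      · rw [map_smul, smul_eq_mul, inv_mul_cancel₀ hα]
      · rw [hω₀α, add_sub_cancel_left, smul_inv_smul₀ hα]
        exact hroot v
  refine ⟨b, hb, ⟨g₀, hg₀, ω₀, hyperplaneChar_ne_zero _, hord, hgb⟩, fun g hg => ?_⟩
  have hpow := hyperplaneChar_pow_eq_one (hfix := hfix) (hu := hu) he ⟨g, hg⟩
  have hepos : 0 < e := by
    rw [← he₀]
    exact orderOf_pos g₀
  have : NeZero e := ⟨hepos.ne'⟩
  obtain ⟨k, -, hk⟩ := (IsPrimitiveRoot.iff_orderOf.2 hord).eq_pow_of_pow_eq_one hpow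
  obtain ⟨s, hs⟩ := exists_pow_mulVec_eq hgb k
  set h : GL (Fin n) F := (g₀ ^ k)⁻¹ * g with hh
  have hhG : h ∈ G := G.mul_mem (G.inv_mem (G.pow_mem hg₀ k)) hg
  have hhroot := mulVec_eq_add_of_fixes_hyperplane (hfix h hhG) hu
  set α := (h : Matrix (Fin n) (Fin n) F) *ᵥ u - u
  have hgh : g = g₀ ^ k * h := by rw [hh, mul_inv_cancel_left]
  have hsplit : χ ⟨g, hg⟩ = ω₀ ^ k * χ ⟨h, hhG⟩ := by
    rw [hω₀, ← map_pow, ← map_mul]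
    congr 1
    exact Subtype.ext hgh
  have hχh : χ ⟨h, hhG⟩ = 1 := by
    rw [hk] at hsplit
    exact (mul_eq_left₀ (hyperplaneChar_ne_zero _)).1 hsplit.symm
  have hα : l α = 0 := by
    rw [hχ, hyperplaneChar_eq (g := ⟨h, hhG⟩) hhroot] at hχh
    simpa using hχh
  have hgroot : ∀ v, (g : Matrix (Fin n) (Fin n) F) *ᵥ v = v + l v • (α + s • (ω₀ - 1) • b) := by
    intro v
    rw [hgh, Units.val_mul, ← Matrix.mulVec_mulVec, hs, hhroot, map_add, map_smul, hα]
    module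
  refine ⟨α, χ ⟨g, hg⟩, hyperplaneChar_ne_zero _, hpow, hα, ⟨h, hhG, hhroot⟩, fun v => ?_⟩
  rw [hgroot, hχ, hyperplaneChar_eq (g := ⟨g, hg⟩) hgroot]
  simp [hα, hb, smul_smul]

end hyperplane

/-- If `G ⊆ GL_n(F_p)` fixes the hyperplane `H = ker l` pointwise, has transvection root
space of dimension `ℓ`, and `e` is the maximal order of a semisimple element of `G`, then
`dim_{F_p} (S/𝔪^{[p^m]})^G = p^{m(n-1)} + p^{m(n-1)-ℓ}·(p^m−1)/e`. -/
theorem stmt_5 (p n m ℓ e : ℕ) [Fact p.Prime] (hm : 1 ≤ m) (hn : 1 ≤ n)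
    (G : Subgroup (GL (Fin n) (ZMod p)))
    (l : (Fin n → ZMod p) →ₗ[ZMod p] ZMod p) (hl : l ≠ 0)
    (hfix : ∀ g ∈ G, ∀ v, l v = 0 →
      Matrix.mulVec (g : Matrix (Fin n) (Fin n) (ZMod p)) v = v)
    (hℓ : Module.finrank (ZMod p) (Submodule.span (ZMod p)
      {α : Fin n → ZMod p | l α = 0 ∧ ∃ g ∈ G, ∀ v,
        Matrix.mulVec (g : Matrix (Fin n) (Fin n) (ZMod p)) v = v + l v • α}) = ℓ)
    (he : IsGreatest {k | ∃ g ∈ G, Module.End.IsSemisimple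
      (Matrix.toLin' (g : Matrix (Fin n) (Fin n) (ZMod p))) ∧ orderOf g = k} e) :
    Module.finrank (ZMod p) (invQuot G (p ^ m))
      = p ^ (m * (n - 1)) + p ^ (m * (n - 1) - ℓ) * ((p ^ m - 1) / e) := by
  classical
  obtain ⟨u, hu⟩ : ∃ u, l u = 1 := LinearMap.surjective hl 1
  obtain ⟨b, hb, ⟨s, hsG, ω, hω, hωe, hs⟩, hG⟩ := exists_hyperplane_complement hfix hu he
  set T := {α : Fin n → ZMod p | l α = 0 ∧ ∃ g ∈ G, ∀ v,
        Matrix.mulVec (g : Matrix (Fin n) (Fin n) (ZMod p)) v = v + l v • α}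
  obtain ⟨B₁, hB₁T, -, hTB₁, hB₁⟩ := exists_linearIndepOn_id_extension
    (linearIndepOn_empty (ZMod p) (id : (Fin n → ZMod p) → _)) (Set.empty_subset T)
  have hB₁ker : B₁ ⊆ (LinearMap.ker l : Set (Fin n → ZMod p)) := fun α hα => (hB₁T hα).1
  obtain ⟨B₂, hB₂ker, hB₁₂, hkerB₂, hB₂⟩ := exists_linearIndepOn_id_extension hB₁ hB₁ker
  have hB₂l : ∀ v ∈ B₂, l v = 0 := fun v hv => hB₂ker hv
  have hspan₂ : Submodule.span (ZMod p) B₂ ≤ LinearMap.ker l := Submodule.span_le.2 hB₂ker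
  have hbB₂ : b ∉ Submodule.span (ZMod p) B₂ := fun h => by
    have := hspan₂ h
    rw [LinearMap.mem_ker, hb] at this
    exact one_ne_zero this
  have hlin : LinearIndepOn (ZMod p) id (insert b B₂) := LinearIndepOn.id_insert hB₂ hbB₂
  let ι := ↥(insert b B₂)
  have hspan : ⊤ ≤ Submodule.span (ZMod p) (Set.range fun i : ι => (i : Fin n → ZMod p)) := by
    intro v _
    rw [Subtype.range_coe, ← sub_add_cancel v (l v • b)]
    refine Submodule.add_mem _ (Submodule.span_mono (Set.subset_insert b B₂) (hkerB₂ ?_))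
      (Submodule.smul_mem _ _ (Submodule.subset_span (Set.mem_insert b B₂)))
    simp [hb]
  let B : Module.Basis ι (ZMod p) (Fin n → ZMod p) := Module.Basis.mk hlin hspan
  have hBv : ∀ i : ι, B i = i := fun i => Module.Basis.mk_apply hlin hspan i
  let o : ι := ⟨b, Set.mem_insert b B₂⟩
  have hι : Fintype.card ι = n := by
    rw [← Module.finrank_eq_card_basis B]
    simp
  let L : Finset ι := Finset.univ.filter fun i => (i : Fin n → ZMod p) ∈ B₁
  have hL : ∀ i, i ∈ L ↔ (i : Fin n → ZMod p) ∈ B₁ := fun i => by simp [L]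
  have ho : o ∉ L := fun h => one_ne_zero (hb.symm.trans (hB₁ker ((hL o).1 h)))
  have hLcard : L.card = ℓ := by
    have hsp : Submodule.span (ZMod p) T = Submodule.span (ZMod p) B₁ :=
      le_antisymm (Submodule.span_le.2 hTB₁) (Submodule.span_mono hB₁T)
    rw [← hℓ, hsp, finrank_span_set_eq_card hB₁]
    refine Finset.card_bij (fun i _ => i) (fun i hi => by simpa using (hL i).1 hi)
      (fun i _ j _ h => Subtype.ext h) fun v hv => ?_
    have hv' : v ∈ B₁ := by simpa using hv
    exact ⟨⟨v, Set.mem_insert_of_mem b (hB₁₂ hv')⟩, (hL _).2 hv', rfl⟩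
  have hcoord_o : B.coord o = l := by
    refine B.ext fun i => ?_
    rw [Module.Basis.coord_apply, Module.Basis.repr_self, hBv]
    by_cases hi : i = o
    · rw [hi, Finsupp.single_eq_same]
      exact hb.symm
    · rw [Finsupp.single_eq_of_ne' hi]
      exact (hB₂l i (i.2.resolve_left fun h => hi (Subtype.ext h))).symm
  have hcoord_T : ∀ i ∉ L, i ≠ o → ∀ α ∈ T, B.coord i α = 0 := by
    intro i hi _ α hα
    have hle : Submodule.span (ZMod p) B₁ ≤ LinearMap.ker (B.coord i) := by
      refine Submodule.span_le.2 fun v hv => ?_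
      have hv' := hBv ⟨v, Set.mem_insert_of_mem b (hB₁₂ hv)⟩
      have hne : (⟨v, Set.mem_insert_of_mem b (hB₁₂ hv)⟩ : ι) ≠ i := fun h =>
        hi ((hL i).2 (h ▸ hv))
      change B.coord i v = 0
      rw [← show B ⟨v, _⟩ = v from hv', Module.Basis.coord_apply, Module.Basis.repr_self,
        Finsupp.single_eq_of_ne' hne]
    exact hle (hTB₁ hα)
  have hcoord : ∀ i j : ι, B.coord i j = if j = i then 1 else 0 := fun i j => by
    rw [← hBv j, Module.Basis.coord_apply, Module.Basis.repr_self, Finsupp.single_apply]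
  let x : ι → MvPolynomial (Fin n) (ZMod p) ⧸ frobIdeal (ZMod p) n (p ^ m) := fun i =>
    Ideal.Quotient.mkₐ (ZMod p) _ (linForm (B.coord i))
  have hx : ∀ i, x i ^ p ^ m = 0 := fun i => by
    rw [← map_pow]
    exact Ideal.Quotient.eq_zero_iff_mem.2 (linForm_pow_mem_frobIdeal m _)
  have hact : ∀ (g : GL (Fin n) (ZMod p)) (β : Fin n → ZMod p),
      (∀ v, (g : Matrix (Fin n) (Fin n) (ZMod p)) *ᵥ v = v + l v • β) →
      ∀ i, gQuot m g (x i) = x i + B.coord i β • x o := by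
    intro g β hg i
    have h1 : B.coord i ∘ₗ Matrix.toLin' (g : Matrix (Fin n) (Fin n) (ZMod p))
        = B.coord i + B.coord i β • B.coord o := by
      refine LinearMap.ext fun v => ?_
      rw [LinearMap.comp_apply, Matrix.toLin'_apply, hg, map_add, map_smul, hcoord_o,
        LinearMap.add_apply, LinearMap.smul_apply, smul_eq_mul, smul_eq_mul, mul_comm]
    rw [gQuot_mk, gSub_linForm, h1, map_add, map_add, map_smul, map_smul]
  have hB_o : ∀ c : ZMod p, B.coord o (c • b) = c := fun c => by simp [hcoord_o, hb]
  have hB_ne : ∀ i ≠ o, ∀ c : ZMod p, B.coord i (c • b) = 0 := fun i hi c => by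
    have h1 : B.coord i b = 0 := (hcoord i o).trans (if_neg hi.symm)
    rw [map_smul, h1, smul_zero]
  suffices h : Module.finrank (ZMod p) (invQuot G (p ^ m))
      = p ^ (m * (Fintype.card ι - 1))
        + p ^ (m * (Fintype.card ι - 1) - L.card) * ((p ^ m - 1) / e) by
    rwa [hι, hLcard] at h
  refine finrank_fixed_of_truncated ho hm hx
    (span_truncated_monomials hx (aeval_linForm_coord_surjective B _))
    (by rw [finrank_quotient_frobIdeal, hι])
    (gQuot m '' (G : Set (GL (Fin n) (ZMod p)))) ?_ ?_ ?_ _ ?_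
  · rintro _ ⟨g, hg, rfl⟩
    obtain ⟨α, ω', hω', hωe', hα, hαT, hgα⟩ := hG g hg
    refine ⟨fun i => B.coord i (α + (ω' - 1) • b), ω', hω', hωe', fun i hi hio => ?_, ?_,
      fun i _ => hact g _ hgα i⟩
    · change B.coord i (α + (ω' - 1) • b) = 0
      rw [map_add, hcoord_T i hi hio α ⟨hα, hαT⟩, hB_ne i hio, add_zero]
    · rw [hact g _ hgα, map_add, hB_o, hcoord_o, hα]
      module
  · intro i hi
    obtain ⟨-, t, htG, ht⟩ := hB₁T ((hL i).1 hi)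
    refine ⟨_, ⟨t, htG, rfl⟩, ?_, fun j hj => ?_⟩
    · rw [hact t _ ht, hcoord, if_pos rfl, one_smul]
    · rw [hact t _ ht, hcoord, if_neg hj.symm, zero_smul, add_zero]
  · refine ⟨_, ⟨s, hsG, rfl⟩, ω, hω, hωe, ?_, fun j hj => ?_⟩
    · rw [hact s _ hs, hB_o]
      module
    · rw [hact s _ hs, hB_ne j hj, zero_smul, add_zero]
  · intro a
    rw [mem_invQuot_iff]
    simp
end

section
/- Let p be a prime, ω ∈ F_p^× of order e, and let G ⊂ GL_n(F_p) be generated by the transvections g_k : x_k ↦ x_k − x_n (1 ≤ k ≤ n−1, fixing other variables) and the diagonal map g_n : x_n ↦ ω^{-1} x_n on V^*. Then the invariant ring F_p[x_1,...,x_n]^G equals the polynomial subalgebra F_p[f_1,...,f_n] where f_i = x_i^p − x_i x_n^{p−1} for i < n and f_n = x_n^e. -/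
open MvPolynomial

/-- A ring endomorphism fixing a monic `N` and not raising degrees commutes with division
by `N`. -/
lemma Polynomial.map_divByMonic_modByMonic_of_fixed {A : Type*} [CommRing A]
    {N : Polynomial A} (hN : N.Monic) (φ : Polynomial A →+* Polynomial A) (hφN : φ N = N)
    (hφ : ∀ r, (φ r).degree ≤ r.degree) {f : Polynomial A} (hf : φ f = f) :
    φ (f /ₘ N) = f /ₘ N ∧ φ (f %ₘ N) = f %ₘ N := by
  nontriviality A
  have h := Polynomial.div_modByMonic_unique (f := f) (φ (f /ₘ N)) (φ (f %ₘ N)) hN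
    ⟨by
      conv_rhs => rw [← hf, ← Polynomial.modByMonic_add_div f N]
      rw [map_add, map_mul, hφN],
      (hφ _).trans_lt (Polynomial.degree_modByMonic_lt f hN)⟩
  exact ⟨h.1.symm, h.2.symm⟩

/-- The polynomial `X ^ p - y ^ (p - 1) X`, the product of all `X - c y` with `c ∈ F_p`. -/
noncomputable def transvectionNorm (p : ℕ) {A : Type*} [CommRing A] (y : A) : Polynomial A :=
  Polynomial.X ^ p - Polynomial.X * Polynomial.C y ^ (p - 1)

lemma degree_X_mul_C_pow_lt {p : ℕ} (hp : 1 < p) {A : Type*} [CommRing A] (y : A) :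
    (Polynomial.X * Polynomial.C y ^ (p - 1) : Polynomial A).degree < (p : WithBot ℕ) := by
  rw [← map_pow, mul_comm]
  exact (Polynomial.degree_C_mul_X_le _).trans_lt (by exact_mod_cast hp)

lemma transvectionNorm_monic {p : ℕ} (hp : 1 < p) {A : Type*} [CommRing A] (y : A) :
    (transvectionNorm p y).Monic :=
  Polynomial.monic_X_pow_sub (degree_X_mul_C_pow_lt hp y)

lemma natDegree_transvectionNorm {p : ℕ} (hp : 1 < p) {A : Type*} [CommRing A] [Nontrivial A]
    (y : A) : (transvectionNorm p y).natDegree = p := by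
  refine Polynomial.natDegree_eq_of_degree_eq_some ?_
  rw [transvectionNorm, Polynomial.degree_sub_eq_left_of_degree_lt, Polynomial.degree_X_pow]
  rw [Polynomial.degree_X_pow]
  exact degree_X_mul_C_pow_lt hp y

lemma transvectionNorm_comp {p : ℕ} [Fact p.Prime] {A : Type*} [CommRing A] [CharP A p] (y : A) :
    (transvectionNorm p y).comp (Polynomial.X - Polynomial.C y) = transvectionNorm p y := by
  have hp : p - 1 + 1 = p := Nat.sub_add_cancel (Fact.out : p.Prime).one_le
  simp only [transvectionNorm, Polynomial.sub_comp, Polynomial.mul_comp, Polynomial.pow_comp,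
    Polynomial.X_comp, Polynomial.C_comp]
  rw [sub_pow_char, sub_mul, ← pow_succ', hp]
  ring

section

variable {p : ℕ} [Fact p.Prime] {A : Type*} [CommRing A] [IsDomain A] [Algebra (ZMod p) A]

lemma Polynomial.eq_C_of_comp_X_sub_C_eq {y : A} (hy : y ≠ 0) {r : Polynomial A}
    (hr : r.comp (Polynomial.X - Polynomial.C y) = r) (hdeg : r.natDegree < p) :
    r = Polynomial.C (r.eval 0) := by
  have hstep (a : A) : r.eval (a - y) = r.eval a := by
    conv_rhs => rw [← hr]
    simp [Polynomial.eval_comp]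
  have heval (m : ℕ) : r.eval ((m : A) * y) = r.eval 0 := by
    induction m with
    | zero => simp
    | succ m ih =>
      rw [← ih, ← hstep]
      congr 1
      push_cast
      ring
  rw [← sub_eq_zero]
  refine Polynomial.eq_zero_of_natDegree_lt_card_of_eval_eq_zero _
    (f := fun c : ZMod p => algebraMap (ZMod p) A c * y) ?_ ?_ ?_
  · intro a b hab
    exact (algebraMap (ZMod p) A).injective (mul_right_cancel₀ hy hab)
  · intro c
    have h := heval c.val
    rw [← map_natCast (algebraMap (ZMod p) A), ZMod.natCast_zmod_val] at h
    simp [h]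
  · simpa [ZMod.card] using hdeg

/-- Polynomials invariant under `X ↦ X - y` and under a set of coefficient endomorphisms fixing
`y ^ (p - 1)` are polynomials in `transvectionNorm p y` with invariant coefficients. -/
lemma mem_adjoin_transvectionNorm {y : A} (hy : y ≠ 0) (T : Set (A →ₐ[ZMod p] A))
    (hT : ∀ σ ∈ T, σ (y ^ (p - 1)) = y ^ (p - 1)) (f : Polynomial A)
    (hf : f.comp (Polynomial.X - Polynomial.C y) = f)
    (hfT : ∀ σ ∈ T, f.map (σ : A →+* A) = f) :
    f ∈ Algebra.adjoin (ZMod p)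
      (Polynomial.C '' {a | ∀ σ ∈ T, σ a = a} ∪ {transvectionNorm p y}) := by
  induction hd : f.natDegree using Nat.strong_induction_on generalizing f with
  | _ d ih =>
  have : CharP A p := charP_of_injective_algebraMap (algebraMap (ZMod p) A).injective p
  set N := transvectionNorm p y with hNdef
  have hN : N.Monic := transvectionNorm_monic (Fact.out : p.Prime).one_lt y
  have hNd : N.natDegree = p := natDegree_transvectionNorm (Fact.out : p.Prime).one_lt y
  have hcomp := Polynomial.map_divByMonic_modByMonic_of_fixed hN
    (Polynomial.compRingHom (Polynomial.X - Polynomial.C y)) (transvectionNorm_comp y)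
    (fun r => by
      rcases eq_or_ne r 0 with rfl | hr
      · simp
      · refine Polynomial.degree_le_of_natDegree_le ?_ |>.trans
          (Polynomial.degree_eq_natDegree hr).ge
        simp [Polynomial.natDegree_comp]) hf
  have hmap σ (hσ : σ ∈ T) := Polynomial.map_divByMonic_modByMonic_of_fixed hN
    (Polynomial.mapRingHom (σ : A →+* A))
    (by
      have := hT σ hσ
      rw [hNdef, transvectionNorm, ← map_pow Polynomial.C]
      simp only [Polynomial.coe_mapRingHom, Polynomial.map_sub, Polynomial.map_mul,
        Polynomial.map_pow, Polynomial.map_X, Polynomial.map_C, RingHom.coe_coe, this])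
    (fun r => Polynomial.degree_map_le) (hfT σ hσ)
  have hr : f %ₘ N = Polynomial.C ((f %ₘ N).eval 0) := by
    refine Polynomial.eq_C_of_comp_X_sub_C_eq (p := p) hy hcomp.2 ?_
    have h1 : N ≠ 1 := by
      rintro h
      rw [h, Polynomial.natDegree_one] at hNd
      exact (Fact.out : p.Prime).ne_zero hNd.symm
    exact hNd ▸ Polynomial.natDegree_modByMonic_lt f hN h1
  have hrmem : f %ₘ N ∈ Algebra.adjoin (ZMod p)
      (Polynomial.C '' {a | ∀ σ ∈ T, σ a = a} ∪ {N}) := by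
    refine Algebra.subset_adjoin (Or.inl ⟨_, fun σ hσ => ?_, hr.symm⟩)
    have h := (hmap σ hσ).2
    rw [hr] at h
    simpa using h
  rw [← Polynomial.modByMonic_add_div f N]
  refine add_mem hrmem ?_
  rcases eq_or_ne (f /ₘ N) 0 with h0 | h0
  · simp [h0]
  refine mul_mem (Algebra.subset_adjoin (Or.inr rfl)) (ih _ ?_ _ hcomp.1
    (fun σ hσ => (hmap σ hσ).1) rfl)
  have hlt : ¬ f.degree < N.degree := fun h => h0 ((Polynomial.divByMonic_eq_zero_iff hN).2 h)
  have hle := Polynomial.natDegree_le_natDegree (not_lt.1 hlt)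
  have hp := (Fact.out : p.Prime).pos
  rw [Polynomial.natDegree_divByMonic f hN]
  omega

end

/-- The transvection `x_k ↦ x_k - x_n`. -/
noncomputable def transvectionHom (p n : ℕ) (k : Fin n) :
    MvPolynomial (Fin (n + 1)) (ZMod p) →ₐ[ZMod p] MvPolynomial (Fin (n + 1)) (ZMod p) :=
  aeval fun i => if i = k.castSucc then X k.castSucc - X (Fin.last n) else X i

/-- The diagonal map `x_n ↦ c x_n`. -/
noncomputable def scaleLastHom (p n : ℕ) (c : ZMod p) :
    MvPolynomial (Fin (n + 1)) (ZMod p) →ₐ[ZMod p] MvPolynomial (Fin (n + 1)) (ZMod p) :=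
  aeval fun i => if i = Fin.last n then C c * X (Fin.last n) else X i

lemma finSuccEquiv_transvectionHom_zero (p n : ℕ) (f : MvPolynomial (Fin (n + 2)) (ZMod p)) :
    finSuccEquiv (ZMod p) (n + 1) (transvectionHom p (n + 1) 0 f) =
      (finSuccEquiv (ZMod p) (n + 1) f).comp
        (Polynomial.X - Polynomial.C (X (Fin.last n))) := by
  induction f using MvPolynomial.induction_on with
  | C a => simp [transvectionHom, finSuccEquiv_apply, algebraMap_eq]
  | add f g hf hg => simp [hf, hg]
  | mul_X f i hf =>
    rw [map_mul, map_mul, hf, map_mul, Polynomial.mul_comp]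
    refine congrArg (HMul.hMul _) ?_
    rcases Fin.eq_zero_or_eq_succ i with rfl | ⟨j, rfl⟩
    · simp [transvectionHom, ← Fin.succ_last, finSuccEquiv_X_succ, finSuccEquiv_X_zero]
    · simp [transvectionHom, finSuccEquiv_X_succ]

lemma finSuccEquiv_transvectionHom_succ (p n : ℕ) (k : Fin n)
    (f : MvPolynomial (Fin (n + 2)) (ZMod p)) :
    finSuccEquiv (ZMod p) (n + 1) (transvectionHom p (n + 1) k.succ f) =
      (finSuccEquiv (ZMod p) (n + 1) f).map
        (transvectionHom p n k : MvPolynomial (Fin (n + 1)) (ZMod p) →+* _) := by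
  induction f using MvPolynomial.induction_on with
  | C a => simp [transvectionHom, finSuccEquiv_apply, algebraMap_eq]
  | add f g hf hg => simp [hf, hg]
  | mul_X f i hf =>
    rw [map_mul, map_mul, hf, map_mul, Polynomial.map_mul]
    refine congrArg (HMul.hMul _) ?_
    rcases Fin.eq_zero_or_eq_succ i with rfl | ⟨j, rfl⟩
    · simp [transvectionHom, finSuccEquiv_X_zero, (Fin.succ_ne_zero _).symm]
    · by_cases h : j = k.castSucc <;>
      simp [transvectionHom, ← Fin.succ_last, finSuccEquiv_X_succ, h]

lemma finSuccEquiv_scaleLastHom (p n : ℕ) (c : ZMod p)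
    (f : MvPolynomial (Fin (n + 2)) (ZMod p)) :
    finSuccEquiv (ZMod p) (n + 1) (scaleLastHom p (n + 1) c f) =
      (finSuccEquiv (ZMod p) (n + 1) f).map
        (scaleLastHom p n c : MvPolynomial (Fin (n + 1)) (ZMod p) →+* _) := by
  induction f using MvPolynomial.induction_on with
  | C a => simp [scaleLastHom, finSuccEquiv_apply, algebraMap_eq]
  | add f g hf hg => simp [hf, hg]
  | mul_X f i hf =>
    rw [map_mul, map_mul, hf, map_mul, Polynomial.map_mul]
    refine congrArg (HMul.hMul _) ?_
    rcases Fin.eq_zero_or_eq_succ i with rfl | ⟨j, rfl⟩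
    · simp [scaleLastHom, finSuccEquiv_X_zero, ← Fin.succ_last, (Fin.succ_ne_zero _).symm]
    · by_cases h : j = Fin.last n <;>
      simp [scaleLastHom, ← Fin.succ_last, h, finSuccEquiv_apply]

lemma coeff_scaleLastHom_zero (p : ℕ) (c : ZMod p) (f : MvPolynomial (Fin 1) (ZMod p))
    (m : Fin 1 →₀ ℕ) : coeff m (scaleLastHom p 0 c f) = c ^ m 0 * coeff m f := by
  induction f using MvPolynomial.induction_on' with
  | add f g hf hg => simp [hf, hg, mul_add]
  | monomial u a =>
    have : scaleLastHom p 0 c (monomial u a) = C (c ^ u 0) * monomial u a := by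
      simp [scaleLastHom, monomial_eq, Finsupp.prod_fintype, mul_pow,
        algebraMap_eq]
      ring
    rw [this, coeff_C_mul, coeff_monomial]
    split_ifs with h <;> simp [h]

lemma mem_adjoin_of_scaleLastHom_zero (p : ℕ) [Fact p.Prime] (ω : (ZMod p)ˣ)
    (f : MvPolynomial (Fin 1) (ZMod p))
    (hf : scaleLastHom p 0 ((ω⁻¹ : (ZMod p)ˣ) : ZMod p) f = f) :
    f ∈ Algebra.adjoin (ZMod p) {(X 0 ^ orderOf ω : MvPolynomial (Fin 1) (ZMod p))} := by
  rw [f.as_sum]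
  refine Subalgebra.sum_mem _ fun m hm => ?_
  have h : (ω⁻¹ ^ m 0 : (ZMod p)ˣ) = 1 := by
    have h := coeff_scaleLastHom_zero p ((ω⁻¹ : (ZMod p)ˣ) : ZMod p) f m
    rw [hf, eq_comm, mul_eq_right₀ (mem_support_iff.1 hm)] at h
    exact Units.ext (by rw [Units.val_pow_eq_pow_val, h, Units.val_one])
  obtain ⟨q, hq⟩ := orderOf_dvd_of_pow_eq_one h
  rw [orderOf_inv] at hq
  have : monomial m (coeff m f) =
      coeff m f • (X 0 ^ orderOf ω : MvPolynomial (Fin 1) (ZMod p)) ^ q := by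
    rw [← pow_mul, ← hq, monomial_eq, smul_eq_C_mul, Finsupp.prod_fintype _ _ (by simp)]
    simp
  rw [this]
  exact Subalgebra.smul_mem _ (pow_mem (Algebra.self_mem_adjoin_singleton _ _) _) _

/-- The generators `x_n ^ e` and `x_i ^ p - x_i x_n ^ (p - 1)` of the invariant ring. -/
def invariantGenerators (p n e : ℕ) : Set (MvPolynomial (Fin (n + 1)) (ZMod p)) :=
  {X (Fin.last n) ^ e} ∪ Set.range fun i : Fin n =>
    X i.castSucc ^ p - X i.castSucc * X (Fin.last n) ^ (p - 1)

section

variable {p : ℕ} [Fact p.Prime] (ω : (ZMod p)ˣ)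

lemma scaleLastHom_X_last_pow (n : ℕ) :
    scaleLastHom p n ((ω⁻¹ : (ZMod p)ˣ) : ZMod p) (X (Fin.last n) ^ (p - 1)) =
      X (Fin.last n) ^ (p - 1) := by
  have h : (((ω⁻¹ : (ZMod p)ˣ) : ZMod p)) ^ (p - 1) = 1 :=
    ZMod.pow_card_sub_one_eq_one (Units.ne_zero _)
  rw [map_pow]
  simp only [scaleLastHom, aeval_X, if_true, mul_pow, ← map_pow, h, map_one, one_mul]

lemma mem_adjoin_invariantGenerators (n : ℕ) (f : MvPolynomial (Fin (n + 1)) (ZMod p))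
    (hf : ∀ k, transvectionHom p n k f = f)
    (hω : scaleLastHom p n ((ω⁻¹ : (ZMod p)ˣ) : ZMod p) f = f) :
    f ∈ Algebra.adjoin (ZMod p) (invariantGenerators p n (orderOf ω)) := by
  induction n with
  | zero =>
    exact Algebra.adjoin_mono (Set.subset_union_left) (mem_adjoin_of_scaleLastHom_zero p ω f hω)
  | succ n ih =>
    set Φ := finSuccEquiv (ZMod p) (n + 1) with hΦ
    have key := mem_adjoin_transvectionNorm (p := p)
      (X_ne_zero (R := ZMod p) (Fin.last n))
      (insert (scaleLastHom p n ((ω⁻¹ : (ZMod p)ˣ) : ZMod p)) (Set.range (transvectionHom p n)))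
      (by
        rintro σ (rfl | ⟨k, rfl⟩)
        · exact scaleLastHom_X_last_pow ω n
        · simp [transvectionHom, (Fin.castSucc_ne_last k).symm])
      (Φ f) (by rw [hΦ, ← finSuccEquiv_transvectionHom_zero, hf])
      (by
        rintro σ (rfl | ⟨k, rfl⟩)
        · rw [hΦ, ← finSuccEquiv_scaleLastHom, hω]
        · rw [hΦ, ← finSuccEquiv_transvectionHom_succ, hf])
    have hΦX (j : Fin (n + 1)) : Φ (X j.succ) = Polynomial.C (X j) := finSuccEquiv_X_succ
    suffices h : Algebra.adjoin (ZMod p) _ ≤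
        (Algebra.adjoin (ZMod p) (invariantGenerators p (n + 1) (orderOf ω))).map
          Φ.toAlgHom by
      obtain ⟨g, hg, hgf⟩ := h key
      have hgf : Φ g = Φ f := hgf
      exact Φ.injective hgf ▸ hg
    rw [Algebra.adjoin_le_iff]
    rintro _ (⟨a, ha, rfl⟩ | rfl)
    · have hmem := ih a (fun k => ha _ (Or.inr ⟨k, rfl⟩)) (ha _ (Or.inl rfl))
      have hCa : Polynomial.C a ∈ (Algebra.adjoin (ZMod p)
          (invariantGenerators p n (orderOf ω))).map
          (Polynomial.CAlgHom (R := ZMod p) (A := MvPolynomial (Fin (n + 1)) (ZMod p))) :=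
        ⟨a, hmem, rfl⟩
      refine (?_ : Subalgebra.map _ _ ≤ _) hCa
      rw [AlgHom.map_adjoin, AlgHom.map_adjoin]
      refine Algebra.adjoin_mono ?_
      rintro _ ⟨_, (rfl | ⟨i, rfl⟩), rfl⟩
      · exact ⟨_, Or.inl rfl, by simp [← Fin.succ_last, hΦX]⟩
      · exact ⟨_, Or.inr ⟨i.succ, rfl⟩, by simp [← Fin.succ_last, hΦX]⟩
    · refine ⟨_, Algebra.subset_adjoin (Or.inr ⟨0, rfl⟩), ?_⟩
      simp [transvectionNorm, ← Fin.succ_last, hΦ, finSuccEquiv_X_zero, finSuccEquiv_X_succ]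

lemma transvectionHom_eq_of_mem_adjoin (n : ℕ) (k : Fin n)
    {f : MvPolynomial (Fin (n + 1)) (ZMod p)} {e : ℕ}
    (hf : f ∈ Algebra.adjoin (ZMod p) (invariantGenerators p n e)) :
    transvectionHom p n k f = f := by
  refine (AlgHom.eqOn_adjoin_iff (φ := transvectionHom p n k) (ψ := AlgHom.id _ _)).2 ?_ hf
  have hlast : transvectionHom p n k (X (Fin.last n)) = X (Fin.last n) := by
    simp [transvectionHom, (Fin.castSucc_ne_last k).symm]
  rintro _ (rfl | ⟨i, rfl⟩)
  · rw [map_pow, hlast, AlgHom.id_apply]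
  · simp only [map_sub, map_mul, map_pow, hlast, AlgHom.id_apply]
    by_cases h : i = k
    · subst h
      have hp : p - 1 + 1 = p := Nat.sub_add_cancel (Fact.out : p.Prime).one_le
      have hi : transvectionHom p n i (X i.castSucc) = X i.castSucc - X (Fin.last n) := by
        simp [transvectionHom]
      rw [hi, sub_pow_char, sub_mul, ← pow_succ', hp]
      ring
    · simp [transvectionHom, h]

lemma scaleLastHom_eq_of_mem_adjoin (n : ℕ) {f : MvPolynomial (Fin (n + 1)) (ZMod p)}
    (hf : f ∈ Algebra.adjoin (ZMod p) (invariantGenerators p n (orderOf ω))) :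
    scaleLastHom p n ((ω⁻¹ : (ZMod p)ˣ) : ZMod p) f = f := by
  refine (AlgHom.eqOn_adjoin_iff (φ := scaleLastHom p n _) (ψ := AlgHom.id _ _)).2 ?_ hf
  rintro _ (rfl | ⟨i, rfl⟩)
  · have h : ((ω⁻¹ : (ZMod p)ˣ) : ZMod p) ^ orderOf ω = 1 := by
      rw [← Units.val_pow_eq_pow_val, inv_pow, pow_orderOf_eq_one, inv_one, Units.val_one]
    rw [map_pow]
    simp only [scaleLastHom, aeval_X, if_true, mul_pow, ← map_pow, h, map_one, one_mul,
      AlgHom.id_apply]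
  · rw [map_sub, map_mul, scaleLastHom_X_last_pow]
    simp only [map_pow, scaleLastHom, aeval_X, if_neg (Fin.castSucc_ne_last i), AlgHom.id_apply]

end

/-- Let `G ⊆ GL_{n+1}(F_p)` be generated by the transvections `g_k : x_k ↦ x_k − x_n`
(`k` among the first `n` variables) and the diagonal map `g_n : x_n ↦ ω⁻¹ x_n`, with
`ω` of order `e`.  A polynomial is `G`-invariant (i.e. fixed by every generator) if and
only if it lies in the subalgebra generated by `f_i = x_i^p − x_i x_n^{p−1}` (`i < n`)
and `f_n = x_n^e`.  The last variable plays the role of `x_n`. -/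
theorem stmt_8 (p n e : ℕ) [Fact p.Prime] (ω : (ZMod p)ˣ) (hω : orderOf ω = e)
    (f : MvPolynomial (Fin (n + 1)) (ZMod p)) :
    ((∀ k : Fin n,
        aeval (R := ZMod p) (fun i : Fin (n + 1) =>
          if i = k.castSucc then X k.castSucc - X (Fin.last n)
          else (X i : MvPolynomial (Fin (n + 1)) (ZMod p))) f = f)
      ∧ aeval (R := ZMod p) (fun i : Fin (n + 1) =>
          if i = Fin.last n then C ((ω⁻¹ : (ZMod p)ˣ) : ZMod p) * X (Fin.last n)
          else (X i : MvPolynomial (Fin (n + 1)) (ZMod p))) f = f)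
    ↔ f ∈ Algebra.adjoin (ZMod p)
        ({X (Fin.last n) ^ e} ∪ Set.range fun i : Fin n =>
          (X i.castSucc ^ p - X i.castSucc * X (Fin.last n) ^ (p - 1)
            : MvPolynomial (Fin (n + 1)) (ZMod p))) := by
  subst hω
  exact ⟨fun h => mem_adjoin_invariantGenerators ω n f h.1 h.2, fun h =>
    ⟨fun k => transvectionHom_eq_of_mem_adjoin n k h, scaleLastHom_eq_of_mem_adjoin ω n h⟩⟩
end

section
/- Let q be a prime power, H = ker(x_n) a hyperplane in F_q^n, and G = GL_n(F_q)_H its pointwise stabilizer. Then F_q[x_1,...,x_n]^G = F_q[f̃_1,...,f̃_n] where f̃_i = x_i^q − x_i x_n^{q−1} for i < n and f̃_n = x_n^{q−1}. -/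
open MvPolynomial Matrix

namespace Polynomial

/-- A polynomial fixed by all translations `X ↦ X + b t`, `b ∈ F`, is a polynomial in
`X ^ q - t ^ (q - 1) X`. -/
theorem mem_adjoin_of_taylor_eq {F A : Type*} [Field F] [Fintype F] [CommRing A] [IsDomain A]
    [Algebra F A] {t : A} (ht : t ≠ 0) (p : A[X])
    (hp : ∀ b : F, taylor (algebraMap F A b * t) p = p) :
    p ∈ Algebra.adjoin A
      {(X ^ Fintype.card F - C (t ^ (Fintype.card F - 1)) * X : A[X])} := by
  set q := Fintype.card F with hq
  have hq1 : 1 < q := Fintype.one_lt_card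
  set D : A[X] := X ^ q - C (t ^ (q - 1)) * X with hD
  have hdeg : (C (t ^ (q - 1)) * X : A[X]).degree < (q : ℕ) :=
    (degree_C_mul_X_le _).trans_lt (by exact_mod_cast hq1)
  have hmon : D.Monic := monic_X_pow_sub (by simpa using hdeg)
  have hnat : D.natDegree = q := by
    have : D.degree = (q : ℕ) := by
      rw [hD, degree_sub_eq_left_of_degree_lt] <;> rw [degree_X_pow]
      exact hdeg
    exact natDegree_eq_of_degree_eq_some this
  have hDinv (b : F) : taylor (algebraMap F A b * t) D = D := by
    have hadd (u v : A[X]) : (u + v) ^ q = u ^ q + v ^ q :=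
      map_add (FiniteField.frobeniusAlgHom F A[X]) u v
    have htq : t ^ (q - 1) * t = t ^ q := pow_sub_one_mul (by omega) t
    have hb : (algebraMap F A b * t) ^ q = t ^ (q - 1) * (algebraMap F A b * t) := by
      rw [mul_pow, ← map_pow, FiniteField.pow_card, ← htq]; ring
    rw [hD, map_sub, taylor_mul, taylor_pow, taylor_X, taylor_C, hadd, ← C_pow, hb, C_mul]
    ring
  induction h : p.natDegree using Nat.strong_induction_on generalizing p with
  | _ m ih =>
  subst h
  have hdecomp := modByMonic_add_div p D
  have hinv (b : F) : taylor (algebraMap F A b * t) (p /ₘ D) = p /ₘ D ∧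
      taylor (algebraMap F A b * t) (p %ₘ D) = p %ₘ D := by
    have := div_modByMonic_unique (f := p) (taylor (algebraMap F A b * t) (p /ₘ D))
      (taylor (algebraMap F A b * t) (p %ₘ D)) hmon
      ⟨by rw [← hDinv b, ← taylor_mul, hDinv b, ← map_add, hdecomp, hp b], by
        rw [degree_taylor]; exact degree_modByMonic_lt p hmon⟩
    exact ⟨this.1.symm, this.2.symm⟩
  have hr : p %ₘ D = C ((p %ₘ D).eval 0) := by
    rw [← sub_eq_zero]
    refine eq_zero_of_natDegree_lt_card_of_eval_eq_zero _
      (f := fun b : F => algebraMap F A b * t) ?_ (fun b => ?_) ?_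
    · exact fun a b hab => (algebraMap F A).injective (mul_right_cancel₀ ht hab)
    · have := congrArg (eval 0) (hinv b).2
      rw [taylor_eval, zero_add] at this
      simp [this]
    · rw [natDegree_sub_C, ← hq, ← hnat]
      exact natDegree_modByMonic_lt p hmon (fun h => by simp [h] at hnat; omega)
  by_cases hp0 : p.natDegree = 0
  · rw [eq_C_of_natDegree_eq_zero hp0]
    exact Subalgebra.algebraMap_mem _ _
  · rw [← hdecomp, hr]
    refine add_mem (Subalgebra.algebraMap_mem _ _)
      (mul_mem (Algebra.self_mem_adjoin_singleton _ _) ?_)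
    exact ih _ (by rw [natDegree_divByMonic p hmon, hnat]; omega) _ (fun b => (hinv b).1) rfl

end Polynomial

section Adjoin

variable {F S : Type*} [Field F] [CommRing S] [Algebra F S]

theorem Algebra.exists_aeval_eq_of_mem_adjoin_union_singleton {s : Set S} {x f : S}
    (hf : f ∈ Algebra.adjoin F (s ∪ {x})) :
    ∃ p : Polynomial (Algebra.adjoin F s), Polynomial.aeval x p = f := by
  rw [Algebra.adjoin_union_eq_adjoin_adjoin, Subalgebra.mem_restrictScalars,
    Algebra.adjoin_singleton_eq_range_aeval] at hf
  exact hf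

theorem AlgHom.eq_self_of_mem_adjoin {s : Set S} (σ : S →ₐ[F] S) (hσ : ∀ y ∈ s, σ y = y)
    {y : S} (hy : y ∈ Algebra.adjoin F s) : σ y = y :=
  AlgHom.adjoin_le_equalizer σ (AlgHom.id F S) hσ hy

theorem AlgHom.map_aeval_adjoin {s : Set S} (σ : S →ₐ[F] S) (hσ : ∀ y ∈ s, σ y = y)
    (x : S) (p : Polynomial (Algebra.adjoin F s)) :
    σ (Polynomial.aeval x p) = Polynomial.aeval (σ x) p := by
  rw [Polynomial.aeval_eq_sum_range, Polynomial.aeval_eq_sum_range, map_sum]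
  refine Finset.sum_congr rfl fun k _ => ?_
  rw [Algebra.smul_def, Algebra.smul_def, map_mul, map_pow]
  congr 1
  exact σ.eq_self_of_mem_adjoin hσ (p.coeff k).2

/-- An element of `F[s][x]` fixed by all translations `x ↦ x + b t` lies in
`F[s][x ^ q - x t ^ (q - 1)]`. -/
theorem Algebra.mem_adjoin_of_translation_invariant [Fintype F] [IsDomain S] {s : Set S}
    {x t f : S} (ht : t ∈ s) (ht0 : t ≠ 0) (hx : Transcendental (Algebra.adjoin F s) x)
    (σ : F → S →ₐ[F] S) (hσs : ∀ b, ∀ y ∈ s, σ b y = y)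
    (hσx : ∀ b, σ b x = x + algebraMap F S b * t) (hσf : ∀ b, σ b f = f)
    (hf : f ∈ Algebra.adjoin F (s ∪ {x})) :
    f ∈ Algebra.adjoin F (s ∪ {x ^ Fintype.card F - x * t ^ (Fintype.card F - 1)}) := by
  obtain ⟨p, rfl⟩ := exists_aeval_eq_of_mem_adjoin_union_singleton hf
  let t' : Algebra.adjoin F s := ⟨t, Algebra.subset_adjoin ht⟩
  have hp : ∀ b : F,
      Polynomial.taylor (algebraMap F (Algebra.adjoin F s) b * t') p = p := fun b => by
    refine transcendental_iff_injective.1 hx ?_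
    rw [Polynomial.taylor_apply, Polynomial.aeval_comp]
    refine Eq.trans ?_ (hσf b)
    rw [(σ b).map_aeval_adjoin (hσs b), hσx]
    simp only [map_add, Polynomial.aeval_X, Polynomial.aeval_C]
    rfl
  have key := Polynomial.mem_adjoin_of_taylor_eq (t := t')
    (fun h => ht0 (congrArg Subtype.val h)) p hp
  rw [Algebra.adjoin_union_eq_adjoin_adjoin, Subalgebra.mem_restrictScalars]
  have := Subalgebra.mem_map.2 ⟨p, key, (rfl : Polynomial.aeval x p = _)⟩
  rw [AlgHom.map_adjoin, Set.image_singleton] at this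
  have hD : Polynomial.aeval x (Polynomial.X ^ Fintype.card F -
      Polynomial.C (t' ^ (Fintype.card F - 1)) * Polynomial.X) =
      x ^ Fintype.card F - x * t ^ (Fintype.card F - 1) := by
    rw [mul_comm x, map_sub, map_mul, map_pow, Polynomial.aeval_X, Polynomial.aeval_C]
    rfl
  rwa [hD] at this

/-- An element of `F[s][t]` fixed by all scalings `t ↦ a t` lies in `F[s][t ^ (q - 1)]`. -/
theorem Algebra.mem_adjoin_of_scaling_invariant [Fintype F] {s : Set S} {t f : S}
    (σ : Fˣ → S →ₐ[F] S) (hσs : ∀ a, ∀ y ∈ s, σ a y = y)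
    (hσt : ∀ a, σ a t = (a : F) • t) (hσf : ∀ a, σ a f = f)
    (hf : f ∈ Algebra.adjoin F (s ∪ {t})) :
    f ∈ Algebra.adjoin F (s ∪ {t ^ (Fintype.card F - 1)}) := by
  classical
  have hsum : ∑ a : Fˣ, σ a f = -f := by
    have := FiniteField.sum_pow_units F 0
    simp only [pow_zero, dvd_zero, if_true] at this
    calc ∑ a : Fˣ, σ a f = ∑ a : Fˣ, (1 : F) • f := by simp only [hσf, one_smul]
      _ = -f := by rw [← Finset.sum_smul, this, neg_one_smul]
  rw [← neg_mem_iff, ← hsum]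
  obtain ⟨p, rfl⟩ := exists_aeval_eq_of_mem_adjoin_union_singleton hf
  simp_rw [fun a => (σ a).map_aeval_adjoin (hσs a), hσt, Polynomial.aeval_eq_sum_range]
  rw [Finset.sum_comm]
  refine sum_mem fun k _ => ?_
  have : ∑ a : Fˣ, p.coeff k • ((a : F) • t) ^ k =
      (p.coeff k : S) * ((∑ a : Fˣ, (a : F) ^ k) • t ^ k) := by
    rw [Finset.sum_smul, Finset.mul_sum]
    exact Finset.sum_congr rfl fun a _ => by rw [smul_pow, Algebra.smul_def]; rfl
  rw [this, FiniteField.sum_pow_units]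
  refine mul_mem (Algebra.adjoin_mono Set.subset_union_left (p.coeff k).2) ?_
  split_ifs with h
  · obtain ⟨m, rfl⟩ := h
    have ht : t ^ (Fintype.card F - 1) ∈
        Algebra.adjoin F (s ∪ {t ^ (Fintype.card F - 1)}) :=
      Algebra.subset_adjoin (Or.inr rfl)
    rw [pow_mul]
    exact Subalgebra.smul_mem _ (pow_mem ht m) _
  · rw [zero_smul]
    exact zero_mem _

end Adjoin

theorem Transcendental.of_subalgebra_le {R S : Type*} [CommRing R] [CommRing S] [Algebra R S]
    {A B : Subalgebra R S} (h : A ≤ B) {x : S} (hx : Transcendental B x) :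
    Transcendental A x := by
  rw [transcendental_iff] at hx ⊢
  intro p hp
  refine Polynomial.map_injective (Subalgebra.inclusion h).toRingHom
    (Subalgebra.inclusion_injective h) ?_
  rw [Polynomial.map_zero]
  refine hx _ ?_
  rw [← hp, Polynomial.aeval_def, Polynomial.eval₂_map]
  rfl

section HyperplaneStabilizer

variable {F : Type} [Field F] {n : ℕ}

theorem gSub_X (g : GL (Fin n) F) (i : Fin n) :
    gSub g (X i) = ∑ j, C ((g : Matrix (Fin n) (Fin n) F) i j) * X j := by
  simp [gSub]

/-- `g` fixes pointwise the hyperplane where the last coordinate vanishes. -/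
def FixesLastHyperplane (g : GL (Fin (n + 1)) F) : Prop :=
  ∀ v : Fin (n + 1) → F, v (Fin.last n) = 0 →
    Matrix.mulVec (g : Matrix (Fin (n + 1)) (Fin (n + 1)) F) v = v

theorem FixesLastHyperplane.apply_castSucc {g : GL (Fin (n + 1)) F}
    (hg : FixesLastHyperplane g) (k : Fin (n + 1)) (j : Fin n) :
    (g : Matrix (Fin (n + 1)) (Fin (n + 1)) F) k j.castSucc =
      (1 : Matrix (Fin (n + 1)) (Fin (n + 1)) F) k j.castSucc := by
  have h := hg (Pi.single j.castSucc 1) (Pi.single_eq_of_ne (Fin.castSucc_lt_last j).ne' _)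
  rw [Matrix.mulVec_single_one] at h
  have := congrFun h k
  rwa [Matrix.col_apply, Pi.single_apply, ← Matrix.one_apply] at this

theorem FixesLastHyperplane.gSub_X_last {g : GL (Fin (n + 1)) F}
    (hg : FixesLastHyperplane g) :
    gSub g (X (Fin.last n)) = C ((g : Matrix (Fin (n + 1)) (Fin (n + 1)) F)
      (Fin.last n) (Fin.last n)) * X (Fin.last n) := by
  rw [gSub_X, Fin.sum_univ_castSucc, Finset.sum_eq_zero, zero_add]
  intro j _
  rw [hg.apply_castSucc, Matrix.one_apply_ne (Fin.castSucc_lt_last j).ne', C_0, zero_mul]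

theorem FixesLastHyperplane.gSub_X_castSucc {g : GL (Fin (n + 1)) F}
    (hg : FixesLastHyperplane g) (i : Fin n) :
    gSub g (X i.castSucc) = X i.castSucc + C ((g : Matrix (Fin (n + 1)) (Fin (n + 1)) F)
      i.castSucc (Fin.last n)) * X (Fin.last n) := by
  rw [gSub_X, Fin.sum_univ_castSucc, Finset.sum_eq_single i]
  · rw [hg.apply_castSucc, Matrix.one_apply_eq, C_1, one_mul]
  · intro j _ hj
    rw [hg.apply_castSucc, Matrix.one_apply_ne, C_0, zero_mul]
    exact fun h => hj (Fin.castSucc_injective n h).symm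
  · simp

theorem FixesLastHyperplane.apply_last_last_ne_zero {g : GL (Fin (n + 1)) F}
    (hg : FixesLastHyperplane g) :
    (g : Matrix (Fin (n + 1)) (Fin (n + 1)) F) (Fin.last n) (Fin.last n) ≠ 0 := by
  intro h
  refine Matrix.GeneralLinearGroup.det_ne_zero g
    (Matrix.det_eq_zero_of_row_eq_zero (Fin.last n) fun j => ?_)
  induction j using Fin.lastCases with
  | last => exact h
  | cast j => rw [hg.apply_castSucc, Matrix.one_apply_ne (Fin.castSucc_lt_last j).ne']

variable (F) in
/-- The translation orbit product `∏ b, (x_i + b x_n) = x_i ^ q - x_i x_n ^ (q - 1)`. -/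
noncomputable def orbitProd [Fintype F] (i : Fin n) : MvPolynomial (Fin (n + 1)) F :=
  X i.castSucc ^ Fintype.card F - X i.castSucc * X (Fin.last n) ^ (Fintype.card F - 1)

theorem FixesLastHyperplane.gSub_X_last_pow [Fintype F] {g : GL (Fin (n + 1)) F}
    (hg : FixesLastHyperplane g) :
    gSub g (X (Fin.last n) ^ (Fintype.card F - 1)) =
      X (Fin.last n) ^ (Fintype.card F - 1) := by
  rw [map_pow, hg.gSub_X_last, mul_pow, ← C_pow,
    FiniteField.pow_card_sub_one_eq_one _ hg.apply_last_last_ne_zero, C_1, one_mul]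

theorem FixesLastHyperplane.gSub_orbitProd [Fintype F] {g : GL (Fin (n + 1)) F}
    (hg : FixesLastHyperplane g) (i : Fin n) :
    gSub g (orbitProd F i) = orbitProd F i := by
  have hadd (u v : MvPolynomial (Fin (n + 1)) F) :
      (u + v) ^ Fintype.card F = u ^ Fintype.card F + v ^ Fintype.card F :=
    map_add (FiniteField.frobeniusAlgHom F _) u v
  rw [orbitProd, map_sub, map_mul, hg.gSub_X_last_pow, map_pow, hg.gSub_X_castSucc, hadd,
    mul_pow, ← C_pow, FiniteField.pow_card,
    ← pow_sub_one_mul Fintype.card_ne_zero (X (Fin.last n))]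
  ring

/-- The translation `x_i ↦ x_i + b x_n`. -/
noncomputable def translation (i : Fin n) (b : F) : GL (Fin (n + 1)) F :=
  Matrix.GeneralLinearGroup.mkOfDetNeZero (Matrix.transvection i.castSucc (Fin.last n) b)
    (by rw [Matrix.det_transvection_of_ne _ _ (Fin.castSucc_lt_last i).ne]; exact one_ne_zero)

theorem coe_translation (i : Fin n) (b : F) :
    (translation i b : Matrix (Fin (n + 1)) (Fin (n + 1)) F) =
      Matrix.transvection i.castSucc (Fin.last n) b := rfl

theorem fixesLastHyperplane_translation (i : Fin n) (b : F) :
    FixesLastHyperplane (translation i b) := by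
  intro v hv
  ext k
  simp [coe_translation, Matrix.transvection, Matrix.add_mulVec, Matrix.single_mulVec, hv]

/-- The scaling `x_n ↦ a x_n`. -/
noncomputable def scaling (n : ℕ) (a : Fˣ) : GL (Fin (n + 1)) F :=
  Matrix.GeneralLinearGroup.mkOfDetNeZero
    (Matrix.diagonal (Function.update 1 (Fin.last n) (a : F)))
    (by
      rw [Matrix.det_diagonal, Finset.prod_ne_zero_iff]
      intro k _
      by_cases h : k = Fin.last n <;> simp [h])

theorem coe_scaling (a : Fˣ) :
    (scaling n a : Matrix (Fin (n + 1)) (Fin (n + 1)) F) =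
      Matrix.diagonal (Function.update 1 (Fin.last n) (a : F)) := rfl

theorem fixesLastHyperplane_scaling (a : Fˣ) : FixesLastHyperplane (scaling n a) := by
  intro v hv
  ext k
  rw [coe_scaling, Matrix.mulVec_diagonal]
  by_cases h : k = Fin.last n <;> simp [h, hv]

theorem gSub_translation_X_self (i : Fin n) (b : F) :
    gSub (translation i b) (X i.castSucc) = X i.castSucc + C b * X (Fin.last n) := by
  rw [(fixesLastHyperplane_translation i b).gSub_X_castSucc]
  simp [coe_translation, Matrix.transvection, Matrix.one_apply_ne (Fin.castSucc_lt_last i).ne]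

theorem gSub_translation_X_of_ne {i : Fin n} {k : Fin (n + 1)} (hk : k ≠ i.castSucc) (b : F) :
    gSub (translation i b) (X k) = X k := by
  rw [gSub_X, Finset.sum_eq_single k]
  · simp [coe_translation, Matrix.transvection, hk.symm]
  · intro j _ hj
    simp [coe_translation, Matrix.transvection, hk.symm,
      Matrix.one_apply_ne hj.symm]
  · simp

variable [Fintype F]

open Classical in
/-- The variables `x_i`, those with index in `T` replaced by their translation orbit product. -/
noncomputable def mixedGen (T : Finset (Fin n)) (i : Fin n) : MvPolynomial (Fin (n + 1)) F :=
  if i ∈ T then orbitProd F i else X i.castSucc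

theorem mem_adjoin_mixedGen {f : MvPolynomial (Fin (n + 1)) F}
    (hf : ∀ (i : Fin n) (b : F), gSub (translation i b) f = f) (T : Finset (Fin n)) :
    f ∈ Algebra.adjoin F ({X (Fin.last n)} ∪ Set.range (mixedGen T)) := by
  classical
  induction T using Finset.induction_on with
  | empty =>
    refine Algebra.adjoin_mono (s := Set.range X) ?_ (by rw [adjoin_range_X]; trivial)
    rintro _ ⟨k, rfl⟩
    induction k using Fin.lastCases with
    | last => exact Or.inl rfl
    | cast i => exact Or.inr ⟨i, by simp [mixedGen]⟩
  | insert i T hi ih =>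
    set s : Set (MvPolynomial (Fin (n + 1)) F) :=
      {X (Fin.last n)} ∪ mixedGen T '' {i}ᶜ with hs
    have hsupp : Algebra.adjoin F s ≤ supported F {i.castSucc}ᶜ := by
      have hlast : (X (Fin.last n) : MvPolynomial (Fin (n + 1)) F) ∈
          supported F {i.castSucc}ᶜ :=
        Algebra.subset_adjoin ⟨_, (Fin.castSucc_lt_last i).ne', rfl⟩
      refine Algebra.adjoin_le ?_
      rintro _ (rfl | ⟨j, hj, rfl⟩)
      · exact hlast
      · have hjX : (X j.castSucc : MvPolynomial (Fin (n + 1)) F) ∈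
            supported F {i.castSucc}ᶜ :=
          Algebra.subset_adjoin ⟨_, fun h => hj (Fin.castSucc_injective n h), rfl⟩
        simp only [mixedGen, SetLike.mem_coe]
        split_ifs
        · exact sub_mem (pow_mem hjX _) (mul_mem hjX (pow_mem hlast _))
        · exact hjX
    have key := Algebra.mem_adjoin_of_translation_invariant (F := F) (s := s) (f := f)
      (x := X i.castSucc) (t := X (Fin.last n)) (Or.inl rfl) (X_ne_zero _)
      ((transcendental_supported_X F (i := i.castSucc) (by simp)).of_subalgebra_le hsupp)
      (fun b => gSub (translation i b)) ?_ (fun b => gSub_translation_X_self i b) (hf i) ?_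
    · refine Algebra.adjoin_mono ?_ key
      rintro _ ((rfl | ⟨j, hj, rfl⟩) | rfl)
      · exact Or.inl rfl
      · have hji : j ≠ i := hj
        exact Or.inr ⟨j, by simp [mixedGen, hji]⟩
      · exact Or.inr ⟨i, by simp [mixedGen, orbitProd]⟩
    · rintro b _ (rfl | ⟨j, hj, rfl⟩)
      · exact gSub_translation_X_of_ne (Fin.castSucc_lt_last i).ne' b
      · simp only [mixedGen]
        split_ifs
        · exact (fixesLastHyperplane_translation i b).gSub_orbitProd j
        · exact gSub_translation_X_of_ne (fun h => hj (Fin.castSucc_injective n h)) b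
    · refine Algebra.adjoin_mono ?_ ih
      rintro _ (rfl | ⟨j, rfl⟩)
      · exact Or.inl (Or.inl rfl)
      · by_cases hj : j = i
        · subst hj
          exact Or.inr (by simp [mixedGen, hi])
        · exact Or.inl (Or.inr ⟨j, hj, rfl⟩)

end HyperplaneStabilizer

/-- For `q` a prime power, `H = ker x_n` and `G = GL_n(F_q)_H` its pointwise stabilizer,
the invariant ring `F_q[x]^G` is the subalgebra generated by
`f̃_i = x_i^q − x_i x_n^{q−1}` (`i < n`) and `f̃_n = x_n^{q−1}`.  The index type is
`Fin (n+1)` with the last variable playing the role of `x_n`. -/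
theorem stmt_9 (q n : ℕ) (F : Type) [Field F] [Fintype F] (hq : Fintype.card F = q)
    (f : MvPolynomial (Fin (n + 1)) F) :
    (∀ g : GL (Fin (n + 1)) F,
        (∀ v : Fin (n + 1) → F, v (Fin.last n) = 0 →
          Matrix.mulVec (g : Matrix (Fin (n + 1)) (Fin (n + 1)) F) v = v) →
        gSub g f = f)
    ↔ f ∈ Algebra.adjoin F
        ({X (Fin.last n) ^ (q - 1)} ∪ Set.range fun i : Fin n =>
          (X i.castSucc ^ q - X i.castSucc * X (Fin.last n) ^ (q - 1)
            : MvPolynomial (Fin (n + 1)) F)) := by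
  subst hq
  constructor
  · intro hf
    have hmem : f ∈ Algebra.adjoin F (Set.range (orbitProd F) ∪ {X (Fin.last n)}) := by
      have h := mem_adjoin_mixedGen
        (fun i b => hf _ (fixesLastHyperplane_translation i b)) Finset.univ
      rw [Set.union_comm] at h
      have hgen : mixedGen Finset.univ = orbitProd F (n := n) := by
        funext i
        simp [mixedGen]
      rwa [hgen] at h
    rw [Set.union_comm]
    refine Algebra.mem_adjoin_of_scaling_invariant (fun a => gSub (scaling n a)) ?_
      (fun a => ?_) (fun a => hf _ (fixesLastHyperplane_scaling a)) hmem
    · rintro a _ ⟨i, rfl⟩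
      exact (fixesLastHyperplane_scaling a).gSub_orbitProd i
    · rw [(fixesLastHyperplane_scaling a).gSub_X_last, coe_scaling, smul_eq_C_mul]
      simp
  · intro hf g hg
    have hg' : FixesLastHyperplane g := hg
    refine (gSub g).eq_self_of_mem_adjoin ?_ hf
    rintro _ (rfl | ⟨i, rfl⟩)
    · exact hg'.gSub_X_last_pow
    · exact hg'.gSub_orbitProd i
end
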